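/- For every δ ∈ (0,1) there exists ω₁ ∈ (0,ω*) such that for every ω ∈ (0,ω₁): there exist λ ∈ (1−δ,1) and functions 𝒱₁, 𝒱₂ ∈ H²(ℝ), not both identically zero, satisfying 𝓛₊𝒱₁ = ωλ·𝒱₂ and 𝓛₋𝒱₂ = ωλ·𝒱₁ on ℝ; moreover, a triple (Ṽ₁, Ṽ₂, μ) with Ṽ₁, Ṽ₂ ∈ H²(ℝ) and μ ≥ 0 satisfies 𝓛₊Ṽ₁ = μ·Ṽ₂ and 𝓛₋Ṽ₂ = μ·Ṽ₁ on ℝ if and only if it has one of the forms (0, 0, μ) with μ ≥ 0, (a·φ_ω′, b·φ_ω, 0) with a, b ∈ ℝ, or (c·𝒱₁, c·𝒱₂, ωλ) with c ∈ ℝ. -/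

import Mathlib

open Real MeasureTheory Filter

/-- The linearized operator `𝓛₊V = -V'' + ωV - (3φ² + g(φ²) + 2φ²g'(φ²))V`. -/
noncomputable def Lplus (g φ : ℝ → ℝ) (ω : ℝ) (V : ℝ → ℝ) (x : ℝ) : ℝ :=
  -(deriv (deriv V) x) + ω * V x
    - (3 * φ x ^ 2 + g (φ x ^ 2) + 2 * φ x ^ 2 * deriv g (φ x ^ 2)) * V x

/-- The linearized operator `𝓛₋V = -V'' + ωV - (φ² + g(φ²))V`. -/
noncomputable def Lminus (g φ : ℝ → ℝ) (ω : ℝ) (V : ℝ → ℝ) (x : ℝ) : ℝ :=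
  -(deriv (deriv V) x) + ω * V x - (φ x ^ 2 + g (φ x ^ 2)) * V x

/-- `V ∈ H²(ℝ)`: twice continuously differentiable with `V, V', V''` square-integrable. -/
def InH2 (V : ℝ → ℝ) : Prop :=
  ContDiff ℝ 2 V ∧ Integrable (fun x => V x ^ 2) ∧
    Integrable (fun x => deriv V x ^ 2) ∧ Integrable (fun x => deriv (deriv V) x ^ 2)

/-! ### Exponentially weighted integrals -/

lemma integrable_exp_neg_mul_abs' {c : ℝ} (hc : 0 < c) :
    Integrable fun t : ℝ => exp (-c * |t|) := by
  have h := integrableOn_exp_mul_Ioi (neg_neg_of_pos hc) 0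
  rw [← integrableOn_univ, ← Set.Iic_union_Ioi (a := (0 : ℝ))]
  refine IntegrableOn.union ?_ (h.congr_fun (fun t ht => ?_) measurableSet_Ioi)
  · have h2 := integrableOn_exp_mul_Iic hc 0
    refine h2.congr_fun (fun t ht => ?_) measurableSet_Iic
    simp only [abs_of_nonpos (Set.mem_Iic.1 ht)]
    ring_nf
  · simp only [abs_of_pos (Set.mem_Ioi.1 ht)]

lemma integral_exp_neg_mul_abs' {c : ℝ} (hc : 0 < c) :
    ∫ t : ℝ, exp (-c * |t|) = 2 / c := by
  rw [integral_comp_abs (f := fun t => exp (-c * t)), integral_exp_mul_Ioi (neg_neg_of_pos hc)]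
  simp
  ring

/-- The exponential weight dominating the potentials. -/
noncomputable def weight (t : ℝ) : ℝ := exp (-(3 / 2) * |t|)

lemma weight_pos (t : ℝ) : 0 < weight t := exp_pos _

lemma integrable_weight : Integrable weight := integrable_exp_neg_mul_abs' (by norm_num)

lemma integral_weight : ∫ t, weight t = 4 / 3 := by
  unfold weight
  rw [integral_exp_neg_mul_abs' (by norm_num)]
  norm_num

lemma exp_abs_mul_weight (t : ℝ) : exp |t| * weight t = exp (-(1 / 2) * |t|) := by
  unfold weight
  rw [← exp_add]
  ring_nf

lemma abs_mul_exp_abs_mul_weight_le (t : ℝ) :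
    |t| * exp |t| * weight t ≤ 4 * exp (-(1 / 4) * |t|) := by
  rw [mul_assoc, exp_abs_mul_weight]
  have h1 : |t| ≤ 4 * exp (1 / 4 * |t|) := by
    have := add_one_le_exp (1 / 4 * |t|)
    linarith
  calc |t| * exp (-(1 / 2) * |t|) ≤ 4 * exp (1 / 4 * |t|) * exp (-(1 / 2) * |t|) := by gcongr
    _ = 4 * exp (-(1 / 4) * |t|) := by
      rw [mul_assoc, ← exp_add]; ring_nf

section Dominated

variable {f : ℝ → ℝ} {N : ℝ}

lemma integrable_of_le_weight (hf : Continuous f) (hN : ∀ t, |f t| ≤ N * weight t) :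
    Integrable f :=
  (integrable_weight.const_mul N).mono' hf.aestronglyMeasurable
    (Eventually.of_forall fun t => by simpa using hN t)

lemma nonneg_of_le_weight (hN : ∀ t, |f t| ≤ N * weight t) : 0 ≤ N := by
  have := (abs_nonneg _).trans (hN 0)
  exact nonneg_of_mul_nonneg_left this (weight_pos 0)

lemma abs_integral_le_of_le_weight (hN : ∀ t, |f t| ≤ N * weight t) :
    |∫ t, f t| ≤ 4 / 3 * N := by
  have := norm_integral_le_of_norm_le (f := f) (integrable_weight.const_mul N)
    (Eventually.of_forall hN)
  rw [integral_const_mul, integral_weight, Real.norm_eq_abs] at this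
  linarith

lemma abs_exp_mul_le (hN : ∀ t, |f t| ≤ N * weight t) {k k' : ℝ} (hk' : 0 ≤ k')
    (hk1 : k' ≤ 1) (hkk : k' ≤ k) (x t : ℝ) :
    |exp (-k * |x - t|) * f t| ≤ N * exp (-k' * |x|) * exp (-(1 / 2) * |t|) := by
  have hN0 := nonneg_of_le_weight hN
  rw [abs_mul, abs_of_pos (exp_pos _), ← exp_abs_mul_weight]
  have h1 : exp (-k * |x - t|) ≤ exp (-k' * |x|) * exp |t| := by
    rw [← exp_add, exp_le_exp]
    have h2 : |x| ≤ |x - t| + |t| := by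
      have := abs_add_le (x - t) t
      simpa using this
    nlinarith [abs_nonneg (x - t), abs_nonneg t]
  calc exp (-k * |x - t|) * |f t| ≤ (exp (-k' * |x|) * exp |t|) * (N * weight t) :=
        mul_le_mul h1 (hN t) (abs_nonneg _) (by positivity)
    _ = _ := by ring

lemma integrable_exp_mul (hf : Continuous f) (hN : ∀ t, |f t| ≤ N * weight t) {k : ℝ}
    (hk : 0 ≤ k) (x : ℝ) : Integrable fun t => exp (-k * |x - t|) * f t := by
  refine ((integrable_exp_neg_mul_abs' (c := 1 / 2) (by norm_num)).const_mul
    (N * exp (-0 * |x|))).mono' (by fun_prop) (Eventually.of_forall fun t => ?_)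
  rw [Real.norm_eq_abs]
  exact abs_exp_mul_le hN le_rfl zero_le_one hk x t

lemma abs_integral_exp_mul_le (hN : ∀ t, |f t| ≤ N * weight t) {k k' : ℝ} (hk' : 0 ≤ k')
    (hk1 : k' ≤ 1) (hkk : k' ≤ k) (x : ℝ) :
    |∫ t, exp (-k * |x - t|) * f t| ≤ 4 * N * exp (-k' * |x|) := by
  have := norm_integral_le_of_norm_le (f := fun t => exp (-k * |x - t|) * f t)
    ((integrable_exp_neg_mul_abs' (c := 1 / 2) (by norm_num)).const_mul (N * exp (-k' * |x|)))
    (Eventually.of_forall (abs_exp_mul_le hN hk' hk1 hkk x))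
  rw [integral_const_mul, integral_exp_neg_mul_abs' (by norm_num), Real.norm_eq_abs] at this
  linarith

lemma abs_exp_sub_exp_le {k : ℝ} (hk : 0 ≤ k) (x t : ℝ) :
    |exp (-k * |x - t|) - exp (-k * |x|)| ≤ k * exp (-k * |x|) * (|t| * exp (k * |t|)) := by
  have ht := abs_nonneg t
  have h2 : |x| ≤ |x - t| + |t| := by
    have := abs_add_le (x - t) t
    simpa using this
  have h3 : |x - t| ≤ |x| + |t| := abs_sub x t
  have e1 : exp (-k * |x - t|) ≤ exp (-k * |x|) * exp (k * |t|) := by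
    rw [← exp_add, exp_le_exp]; nlinarith
  have e2 : exp (-k * |x|) * exp (-(k * |t|)) ≤ exp (-k * |x - t|) := by
    rw [← exp_add, exp_le_exp]; nlinarith
  have e3 : 1 - k * |t| ≤ exp (-(k * |t|)) := by linarith [add_one_le_exp (-(k * |t|))]
  have e4 : exp (k * |t|) - 1 ≤ k * |t| * exp (k * |t|) := by
    have := mul_le_mul_of_nonneg_right e3 (exp_pos (k * |t|)).le
    rw [← exp_add] at this
    simp at this
    linarith
  have e5 : k * |t| ≤ k * |t| * exp (k * |t|) :=
    le_mul_of_one_le_right (by positivity) (one_le_exp (by positivity))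
  have hp := exp_pos (-k * |x|)
  rw [abs_le]
  constructor
  · nlinarith
  · nlinarith

lemma abs_integral_exp_sub_mul_le (hN : ∀ t, |f t| ≤ N * weight t)
    {k : ℝ} (hk : 0 ≤ k) (hk1 : k ≤ 1) (x : ℝ) :
    |∫ t, (exp (-k * |x - t|) - exp (-k * |x|)) * f t| ≤ k * (32 * N * exp (-k * |x|)) := by
  have hN0 := nonneg_of_le_weight hN
  have hb : ∀ t, ‖(exp (-k * |x - t|) - exp (-k * |x|)) * f t‖
      ≤ k * exp (-k * |x|) * N * 4 * exp (-(1 / 4) * |t|) := by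
    intro t
    rw [Real.norm_eq_abs, abs_mul]
    have h1 := abs_exp_sub_exp_le hk x t
    have h2 := abs_mul_exp_abs_mul_weight_le t
    have h3 : exp (k * |t|) ≤ exp |t| := exp_le_exp.2 (by nlinarith [abs_nonneg t])
    calc _ ≤ (k * exp (-k * |x|) * (|t| * exp (k * |t|))) * (N * weight t) :=
          mul_le_mul h1 (hN t) (abs_nonneg _) (by positivity)
      _ ≤ (k * exp (-k * |x|) * (|t| * exp |t|)) * (N * weight t) := by
          have := weight_pos t
          gcongr
      _ = k * exp (-k * |x|) * N * (|t| * exp |t| * weight t) := by ring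
      _ ≤ k * exp (-k * |x|) * N * (4 * exp (-(1 / 4) * |t|)) := by gcongr
      _ = _ := by ring
  have := norm_integral_le_of_norm_le
    ((integrable_exp_neg_mul_abs' (c := 1 / 4) (by norm_num)).const_mul
      (k * exp (-k * |x|) * N * 4)) (Eventually.of_forall hb)
  rw [integral_const_mul, integral_exp_neg_mul_abs' (by norm_num), Real.norm_eq_abs] at this
  linarith

lemma integrableOn_exp_mul_Iic' (hf : Continuous f) (hN : ∀ t, |f t| ≤ N * weight t) {k : ℝ}
    (hk : 0 ≤ k) (x : ℝ) : IntegrableOn (fun t => exp (k * t) * f t) (Set.Iic x) := by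
  refine (((integrable_exp_mul hf hN hk x).const_mul (exp (k * x))).integrableOn).congr_fun
    (fun t ht => ?_) measurableSet_Iic
  simp only [abs_of_nonneg (sub_nonneg.2 (Set.mem_Iic.1 ht)), ← mul_assoc, ← exp_add]
  ring_nf

lemma integrableOn_exp_mul_Ioi' (hf : Continuous f) (hN : ∀ t, |f t| ≤ N * weight t) {k : ℝ}
    (hk : 0 ≤ k) (x : ℝ) : IntegrableOn (fun t => exp (-k * t) * f t) (Set.Ioi x) := by
  refine (((integrable_exp_mul hf hN hk x).const_mul (exp (-k * x))).integrableOn).congr_fun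
    (fun t ht => ?_) measurableSet_Ioi
  simp only [abs_of_neg (sub_neg.2 (Set.mem_Ioi.1 ht)), ← mul_assoc, ← exp_add]
  ring_nf

lemma integral_exp_mul_eq_add (hf : Continuous f) (hN : ∀ t, |f t| ≤ N * weight t) {k : ℝ}
    (hk : 0 ≤ k) (x : ℝ) :
    ∫ t, exp (-k * |x - t|) * f t = exp (-k * x) * (∫ t in Set.Iic x, exp (k * t) * f t)
      + exp (k * x) * ∫ t in Set.Ioi x, exp (-k * t) * f t := by
  have hi := integrable_exp_mul hf hN hk x
  rw [← setIntegral_univ, ← Set.Iic_union_Ioi (a := x),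
    setIntegral_union (Set.Iic_disjoint_Ioi le_rfl) measurableSet_Ioi hi.integrableOn
      hi.integrableOn, ← integral_const_mul, ← integral_const_mul]
  congr 1
  · refine setIntegral_congr_fun measurableSet_Iic fun t ht => ?_
    simp only [abs_of_nonneg (sub_nonneg.2 (Set.mem_Iic.1 ht)), ← mul_assoc, ← exp_add]
    ring_nf
  · refine setIntegral_congr_fun measurableSet_Ioi fun t ht => ?_
    simp only [abs_of_neg (sub_neg.2 (Set.mem_Ioi.1 ht)), ← mul_assoc, ← exp_add]
    ring_nf

/-- Decaying solutions of `u'' = k²u + f` are given by the Green kernel of `-∂² + k²`. -/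
lemma green_representation (hf : Continuous f) (hN : ∀ t, |f t| ≤ N * weight t) {k : ℝ}
    (hk : 0 < k) {u u' : ℝ → ℝ} (hu : ∀ x, HasDerivAt u (u' x) x)
    (hu' : ∀ x, HasDerivAt u' (k ^ 2 * u x + f x) x)
    (h0 : Tendsto u atTop (nhds 0)) (h0' : Tendsto u' atTop (nhds 0))
    (h1 : Tendsto u atBot (nhds 0)) (h1' : Tendsto u' atBot (nhds 0)) (x : ℝ) :
    2 * k * u x = -∫ t, exp (-k * |x - t|) * f t := by
  have hR : ∫ t in Set.Ioi x, exp (-k * t) * f t = 0 - exp (-k * x) * (u' x + k * u x) := by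
    refine integral_Ioi_of_hasDerivAt_of_tendsto' (f := fun t => exp (-k * t) * (u' t + k * u t))
      (fun t _ => ?_) (integrableOn_exp_mul_Ioi' hf hN hk.le x) ?_
    · have he : HasDerivAt (fun t : ℝ => exp (-k * t)) (exp (-k * t) * (-k * 1)) t :=
        ((hasDerivAt_id t).const_mul (-k)).exp
      refine (he.mul ((hu' t).add ((hu t).const_mul k))).congr_deriv ?_
      simp only [Pi.add_apply]
      ring
    · have he : Tendsto (fun t : ℝ => exp (-k * t)) atTop (nhds 0) :=
        tendsto_exp_atBot.comp (tendsto_id.const_mul_atTop_of_neg (neg_neg_of_pos hk))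
      simpa using he.mul (h0'.add (h0.const_mul k))
  have hL : ∫ t in Set.Iic x, exp (k * t) * f t = exp (k * x) * (u' x - k * u x) - 0 := by
    refine integral_Iic_of_hasDerivAt_of_tendsto' (f := fun t => exp (k * t) * (u' t - k * u t))
      (fun t _ => ?_) (integrableOn_exp_mul_Iic' hf hN hk.le x) ?_
    · have he : HasDerivAt (fun t : ℝ => exp (k * t)) (exp (k * t) * (k * 1)) t :=
        ((hasDerivAt_id t).const_mul k).exp
      refine (he.mul ((hu' t).sub ((hu t).const_mul k))).congr_deriv ?_
      simp only [Pi.sub_apply]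
      ring
    · have he : Tendsto (fun t : ℝ => exp (k * t)) atBot (nhds 0) :=
        tendsto_exp_atBot.comp (tendsto_id.const_mul_atBot hk)
      simpa using he.mul (h1'.sub (h1.const_mul k))
  have he : exp (-k * x) * exp (k * x) = 1 := by rw [← exp_add]; simp
  rw [integral_exp_mul_eq_add hf hN hk.le, hR, hL]
  linear_combination (-2 * k * u x) * he

lemma hasDerivAt_integral_Iic {F : ℝ → ℝ} (hF : Continuous F)
    (hi : ∀ x, IntegrableOn F (Set.Iic x)) (x : ℝ) :
    HasDerivAt (fun x => ∫ t in Set.Iic x, F t) (F x) x := by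
  have h : (fun x => ∫ t in Set.Iic x, F t)
      = fun x => (∫ t in Set.Iic 0, F t) + ∫ t in (0 : ℝ)..x, F t := by
    ext y
    rw [← intervalIntegral.integral_Iic_sub_Iic (hi 0) (hi y)]
    ring
  rw [h]
  exact (intervalIntegral.integral_hasDerivAt_right (hF.intervalIntegrable _ _)
    (hF.stronglyMeasurableAtFilter _ _) hF.continuousAt).const_add _

lemma hasDerivAt_integral_Ioi {F : ℝ → ℝ} (hF : Continuous F)
    (hi : ∀ x, IntegrableOn F (Set.Ioi x)) (x : ℝ) :
    HasDerivAt (fun x => ∫ t in Set.Ioi x, F t) (-F x) x := by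
  have h : (fun x => ∫ t in Set.Ioi x, F t)
      = fun x => (∫ t in Set.Ioi 0, F t) - ∫ t in (0 : ℝ)..x, F t := by
    ext y
    rw [← intervalIntegral.integral_Ioi_sub_Ioi' (hi 0) (hi y)]
    ring
  rw [h]
  exact (intervalIntegral.integral_hasDerivAt_right (hF.intervalIntegrable _ _)
    (hF.stronglyMeasurableAtFilter _ _) hF.continuousAt).const_sub _

/-- The Green kernel of `-∂² + k²` solves `u'' = k²u + f`. -/
lemma green_solution (hf : Continuous f) (hN : ∀ t, |f t| ≤ N * weight t) {k : ℝ}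
    (hk : 0 < k) {u : ℝ → ℝ}
    (hu : ∀ x, 2 * k * u x = -∫ t, exp (-k * |x - t|) * f t) :
    ∃ u' : ℝ → ℝ, (∀ x, HasDerivAt u (u' x) x) ∧
      (∀ x, HasDerivAt u' (k ^ 2 * u x + f x) x) ∧
      ∀ k', 0 ≤ k' → k' ≤ 1 → k' ≤ k → ∀ x, |u' x| ≤ 2 * N * exp (-k' * |x|) := by
  set L : ℝ → ℝ := fun x => ∫ t in Set.Iic x, exp (k * t) * f t with hL
  set R : ℝ → ℝ := fun x => ∫ t in Set.Ioi x, exp (-k * t) * f t with hR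
  have dL : ∀ x, HasDerivAt L (exp (k * x) * f x) x := hasDerivAt_integral_Iic (by fun_prop)
    (integrableOn_exp_mul_Iic' hf hN hk.le)
  have dR : ∀ x, HasDerivAt R (-(exp (-k * x) * f x)) x := hasDerivAt_integral_Ioi (by fun_prop)
    (integrableOn_exp_mul_Ioi' hf hN hk.le)
  have hsum : ∀ x, ∫ t, exp (-k * |x - t|) * f t = exp (-k * x) * L x + exp (k * x) * R x :=
    integral_exp_mul_eq_add hf hN hk.le
  have hu2 : u = fun x => -(exp (-k * x) * L x + exp (k * x) * R x) / (2 * k) := by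
    ext x
    rw [← hsum, ← hu]
    field_simp
  have hem : ∀ x, HasDerivAt (fun t : ℝ => exp (-k * t)) (exp (-k * x) * (-k * 1)) x := fun x =>
    ((hasDerivAt_id x).const_mul (-k)).exp
  have hep : ∀ x, HasDerivAt (fun t : ℝ => exp (k * t)) (exp (k * x) * (k * 1)) x := fun x =>
    ((hasDerivAt_id x).const_mul k).exp
  have he : ∀ x, exp (-k * x) * exp (k * x) = 1 := fun x => by rw [← exp_add]; simp
  refine ⟨fun x => (exp (-k * x) * L x - exp (k * x) * R x) / 2, fun x => ?_, fun x => ?_, ?_⟩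
  · rw [hu2]
    refine ((((hem x).mul (dL x)).add ((hep x).mul (dR x))).neg.div_const (2 * k)).congr_deriv ?_
    field_simp
    ring
  · refine ((((hem x).mul (dL x)).sub ((hep x).mul (dR x))).div_const 2).congr_deriv ?_
    have : u x = -(exp (-k * x) * L x + exp (k * x) * R x) / (2 * k) := by rw [hu2]
    rw [this]
    have hx := he x
    generalize exp (-k * x) = a at *
    generalize exp (k * x) = b at *
    field_simp
    linear_combination (2 * f x) * hx
  · intro k' hk' hk1 hkk x
    have hi := integrable_exp_mul (f := fun t => |f t|) (N := N) hf.abs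
      (fun t => by simpa using hN t) hk.le x
    have h4 := abs_integral_exp_mul_le (f := fun t => |f t|) (N := N)
      (fun t => by simpa using hN t) hk' hk1 hkk x
    rw [integral_exp_mul_eq_add hf.abs (N := N) (fun t => by simpa using hN t) hk.le] at h4
    have hLa : |L x| ≤ ∫ t in Set.Iic x, exp (k * t) * |f t| := by
      refine (abs_integral_le_integral_abs).trans (le_of_eq ?_)
      simp only [abs_mul, abs_exp]
    have hRa : |R x| ≤ ∫ t in Set.Ioi x, exp (-k * t) * |f t| := by
      refine (abs_integral_le_integral_abs).trans (le_of_eq ?_)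
      simp only [abs_mul, abs_exp]
    have h5 : |exp (-k * x) * L x - exp (k * x) * R x| ≤ exp (-k * x) * |L x|
        + exp (k * x) * |R x| := by
      refine (abs_sub _ _).trans (le_of_eq ?_)
      simp only [abs_mul, abs_exp]
    have h6 := mul_le_mul_of_nonneg_left hLa (exp_pos (-k * x)).le
    have h7 := mul_le_mul_of_nonneg_left hRa (exp_pos (k * x)).le
    rw [abs_div, abs_two, div_le_iff₀ two_pos]
    linarith [(le_abs_self _).trans h4]

end Dominated

/-! ### Functions vanishing at both ends of the line -/

/-- `f` tends to `0` at `+∞` and at `-∞`. -/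
def Vanishes (f : ℝ → ℝ) : Prop :=
  Tendsto f atTop (nhds 0) ∧ Tendsto f atBot (nhds 0)

namespace Vanishes

variable {f h : ℝ → ℝ}

lemma add (hf : Vanishes f) (hh : Vanishes h) : Vanishes fun x => f x + h x :=
  ⟨by simpa using hf.1.add hh.1, by simpa using hf.2.add hh.2⟩

lemma sub (hf : Vanishes f) (hh : Vanishes h) : Vanishes fun x => f x - h x :=
  ⟨by simpa using hf.1.sub hh.1, by simpa using hf.2.sub hh.2⟩

lemma const_mul (c : ℝ) (hf : Vanishes f) : Vanishes fun x => c * f x :=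
  ⟨by simpa using hf.1.const_mul c, by simpa using hf.2.const_mul c⟩

lemma mul (hf : Vanishes f) (hh : Vanishes h) : Vanishes fun x => f x * h x :=
  ⟨by simpa using hf.1.mul hh.1, by simpa using hf.2.mul hh.2⟩

lemma bdd_mul {C : ℝ} (hC : ∀ x, |h x| ≤ C) (hf : Vanishes f) :
    Vanishes fun x => h x * f x := by
  have key : ∀ l : Filter ℝ, Tendsto f l (nhds 0) → Tendsto (fun x => h x * f x) l (nhds 0) := by
    intro l hl
    refine squeeze_zero_norm (a := fun x => C * |f x|) (fun x => ?_)
      (by simpa using hl.abs.const_mul C)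
    rw [Real.norm_eq_abs, abs_mul]
    exact mul_le_mul_of_nonneg_right (hC x) (abs_nonneg _)
  exact ⟨key _ hf.1, key _ hf.2⟩

lemma comp_neg (hf : Vanishes f) : Vanishes fun x => f (-x) :=
  ⟨hf.2.comp tendsto_neg_atTop_atBot, hf.1.comp tendsto_neg_atBot_atTop⟩

lemma exists_bound (hf : Vanishes f) (hc : Continuous f) : ∃ M, ∀ x, |f x| ≤ M := by
  obtain ⟨a, ha⟩ := eventually_atTop.1
    ((by simpa using hf.1.abs : Tendsto (fun x => |f x|) atTop (nhds 0)).eventually_lt_const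
      one_pos)
  obtain ⟨b, hb⟩ := eventually_atBot.1
    ((by simpa using hf.2.abs : Tendsto (fun x => |f x|) atBot (nhds 0)).eventually_lt_const
      one_pos)
  obtain ⟨C, hC⟩ := (isCompact_Icc (a := b) (b := a)).exists_bound_of_continuousOn hc.continuousOn
  refine ⟨max C 1, fun x => ?_⟩
  by_cases h1 : a ≤ x
  · exact (ha x h1).le.trans (le_max_right _ _)
  by_cases h2 : x ≤ b
  · exact (hb x h2).le.trans (le_max_right _ _)
  · exact (hC x ⟨by linarith, by linarith⟩).trans (le_max_left _ _)

end Vanishes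

lemma vanishes_exp_neg_mul_abs {k : ℝ} (hk : 0 < k) : Vanishes fun x => exp (-k * |x|) :=
  ⟨tendsto_exp_atBot.comp (tendsto_abs_atTop_atTop.const_mul_atTop_of_neg (neg_neg_of_pos hk)),
    tendsto_exp_atBot.comp (tendsto_abs_atBot_atTop.const_mul_atTop_of_neg (neg_neg_of_pos hk))⟩

lemma vanishes_of_le_exp {f : ℝ → ℝ} {C k : ℝ} (hk : 0 < k)
    (h : ∀ x, |f x| ≤ C * exp (-k * |x|)) : Vanishes f :=
  ⟨squeeze_zero_norm h (by simpa using (vanishes_exp_neg_mul_abs hk).1.const_mul C),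
    squeeze_zero_norm h (by simpa using (vanishes_exp_neg_mul_abs hk).2.const_mul C)⟩

/-! ### Decaying solutions above the threshold -/

section Oscillating

variable {f u u' : ℝ → ℝ} {N : ℝ}

lemma abs_mul_weight_le (t : ℝ) : |t| * weight t ≤ 4 * exp (-(1 / 4) * |t|) := by
  refine le_trans ?_ (abs_mul_exp_abs_mul_weight_le t)
  have := weight_pos t
  have h1 : 1 ≤ exp |t| := one_le_exp (abs_nonneg t)
  have : |t| ≤ |t| * exp |t| := le_mul_of_one_le_right (abs_nonneg t) h1
  gcongr

lemma abs_setIntegral_le_of_le_abs_mul {F : ℝ → ℝ} (hN : 0 ≤ N) {x : ℝ}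
    (hF : ∀ t ∈ Set.Ioi x, |F t| ≤ N * (|t| * weight t)) : |∫ t in Set.Ioi x, F t| ≤ 32 * N := by
  have hi : Integrable fun t : ℝ => N * 4 * exp (-(1 / 4) * |t|) :=
    (integrable_exp_neg_mul_abs' (by norm_num)).const_mul _
  have h1 := norm_integral_le_of_norm_le (μ := volume.restrict (Set.Ioi x)) (f := F)
    hi.integrableOn ((ae_restrict_mem measurableSet_Ioi).mono fun t ht => by
      have := mul_le_mul_of_nonneg_left (abs_mul_weight_le t) hN
      rw [Real.norm_eq_abs]
      linarith [hF t ht])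
  have h2 := setIntegral_le_integral (s := Set.Ioi x) hi
    (Eventually.of_forall fun t => by positivity)
  have h3 : ∫ t : ℝ, N * 4 * exp (-(1 / 4) * |t|) = N * 4 * (2 / (1 / 4)) := by
    rw [integral_const_mul, integral_exp_neg_mul_abs' (by norm_num)]
  rw [h3] at h2
  rw [Real.norm_eq_abs] at h1
  linarith

lemma integrableOn_of_le_abs_mul {F : ℝ → ℝ} (hF : Continuous F) (hN : 0 ≤ N) {x : ℝ}
    (hb : ∀ t ∈ Set.Ioi x, |F t| ≤ N * (|t| * weight t)) : IntegrableOn F (Set.Ioi x) := by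
  have hi : Integrable fun t : ℝ => N * 4 * exp (-(1 / 4) * |t|) :=
    (integrable_exp_neg_mul_abs' (by norm_num)).const_mul _
  refine hi.integrableOn.mono' hF.aestronglyMeasurable
    ((ae_restrict_mem measurableSet_Ioi).mono fun t ht => ?_)
  have := mul_le_mul_of_nonneg_left (abs_mul_weight_le t) hN
  rw [Real.norm_eq_abs]
  linarith [hb t ht]

lemma abs_le_of_oscillating_right (hf : Continuous f) (hN : ∀ t, |f t| ≤ N * weight t) {k : ℝ}
    (hk : 0 < k) (hu : ∀ x, HasDerivAt u (u' x) x)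
    (hu' : ∀ x, HasDerivAt u' (-k ^ 2 * u x + f x) x)
    (h0 : Tendsto u atTop (nhds 0)) (h0' : Tendsto u' atTop (nhds 0)) {x : ℝ} (hx : 0 ≤ x) :
    |u x| ≤ 32 * N := by
  have hN0 := nonneg_of_le_weight hN
  have hb : ∀ t ∈ Set.Ioi x, |-(f t * (sin (k * (t - x)) / k))| ≤ N * (|t| * weight t) := by
    intro t ht
    have ht : x < t := ht
    rw [abs_neg, abs_mul]
    have h1 : |sin (k * (t - x)) / k| ≤ |t| := by
      rw [abs_div, abs_of_pos hk, div_le_iff₀ hk]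
      refine (abs_sin_le_abs).trans ?_
      rw [abs_mul, abs_of_pos hk, abs_of_pos (by linarith), abs_of_pos (by linarith)]
      nlinarith
    calc |f t| * |sin (k * (t - x)) / k| ≤ (N * weight t) * |t| :=
          mul_le_mul (hN t) h1 (abs_nonneg _) (mul_nonneg hN0 (weight_pos t).le)
      _ = _ := by ring
  have key : ∫ t in Set.Ioi x, -(f t * (sin (k * (t - x)) / k))
      = 0 - (u x * cos (k * (x - x)) - u' x * (sin (k * (x - x)) / k)) := by
    refine integral_Ioi_of_hasDerivAt_of_tendsto'
      (f := fun t => u t * cos (k * (t - x)) - u' t * (sin (k * (t - x)) / k))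
      (fun t _ => ?_) (integrableOn_of_le_abs_mul (by fun_prop) hN0 hb) ?_
    · have hl : HasDerivAt (fun t : ℝ => k * (t - x)) (k * 1) t :=
        ((hasDerivAt_id t).sub_const x).const_mul k
      refine (((hu t).mul hl.cos).sub ((hu' t).mul (hl.sin.div_const k))).congr_deriv ?_
      field_simp
      ring
    · have e1 : Tendsto (fun t => u t * cos (k * (t - x))) atTop (nhds 0) := by
        refine squeeze_zero_norm (fun t => ?_) (by simpa using h0.abs)
        rw [norm_mul, Real.norm_eq_abs, Real.norm_eq_abs]
        exact mul_le_of_le_one_right (abs_nonneg _) (abs_cos_le_one _)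
      have e2 : Tendsto (fun t => u' t * (sin (k * (t - x)) / k)) atTop (nhds 0) := by
        refine squeeze_zero_norm (a := fun t => |u' t| * (1 / k)) (fun t => ?_)
          (by simpa using h0'.abs.mul_const (1 / k))
        rw [norm_mul, Real.norm_eq_abs, Real.norm_eq_abs, abs_div, abs_of_pos hk]
        have := abs_sin_le_one (k * (t - x))
        gcongr
      simpa using e1.sub e2
  have := abs_setIntegral_le_of_le_abs_mul hN0 hb
  rw [key] at this
  simpa using this

lemma abs_le_of_free_right (hf : Continuous f) (hN : ∀ t, |f t| ≤ N * weight t)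
    (hu : ∀ x, HasDerivAt u (u' x) x) (hu' : ∀ x, HasDerivAt u' (f x) x)
    (h0 : Tendsto u atTop (nhds 0)) (h0' : Tendsto u' atTop (nhds 0)) {x : ℝ} (hx : 0 ≤ x) :
    |u x| ≤ 32 * N := by
  have hN0 := nonneg_of_le_weight hN
  have hb : ∀ t ∈ Set.Ioi x, |-((t - x) * f t)| ≤ N * (|t| * weight t) := by
    intro t ht
    have ht : x < t := ht
    rw [abs_neg, abs_mul]
    have h1 : |t - x| ≤ |t| := by
      rw [abs_of_pos (by linarith), abs_of_pos (by linarith)]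
      linarith
    calc |t - x| * |f t| ≤ |t| * (N * weight t) :=
          mul_le_mul h1 (hN t) (abs_nonneg _) (abs_nonneg t)
      _ = _ := by ring
  have hdec : ∀ y, 0 ≤ y → |u' y| ≤ 4 * N * exp (-(1 / 2) * y) := by
    intro y hy
    have h1 : ∫ t in Set.Ioi y, f t = 0 - u' y :=
      integral_Ioi_of_hasDerivAt_of_tendsto' (fun t _ => hu' t)
        (integrable_of_le_weight hf hN).integrableOn h0'
    have hi : Integrable fun t : ℝ => N * exp (-(1 / 2) * y) * exp (-1 * |t|) :=
      (integrable_exp_neg_mul_abs' (by norm_num)).const_mul _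
    have h2 := norm_integral_le_of_norm_le (μ := volume.restrict (Set.Ioi y)) (f := f)
      hi.integrableOn ((ae_restrict_mem measurableSet_Ioi).mono fun t ht => by
        have ht : y < t := ht
        refine (hN t).trans ?_
        rw [mul_assoc]
        refine mul_le_mul_of_nonneg_left ?_ hN0
        unfold weight
        rw [← exp_add, exp_le_exp, abs_of_pos (by linarith)]
        linarith)
    have h3 := setIntegral_le_integral (s := Set.Ioi y) hi
      (Eventually.of_forall fun t => by positivity)
    have h4 : ∫ t : ℝ, N * exp (-(1 / 2) * y) * exp (-1 * |t|)
        = N * exp (-(1 / 2) * y) * (2 / 1) := by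
      rw [integral_const_mul, integral_exp_neg_mul_abs' (by norm_num)]
    rw [h4] at h3
    rw [Real.norm_eq_abs, h1, zero_sub, abs_neg] at h2
    have : 0 ≤ N * exp (-(1 / 2) * y) := by positivity
    linarith
  have key : ∫ t in Set.Ioi x, -((t - x) * f t) = 0 - (u x - (x - x) * u' x) := by
    refine integral_Ioi_of_hasDerivAt_of_tendsto' (f := fun t => u t - (t - x) * u' t)
      (fun t _ => ?_) (integrableOn_of_le_abs_mul (by fun_prop) hN0 hb) ?_
    · have hl : HasDerivAt (fun t : ℝ => t - x) 1 t := (hasDerivAt_id t).sub_const x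
      refine ((hu t).sub (hl.mul (hu' t))).congr_deriv ?_
      ring
    · have e2 : Tendsto (fun t => (t - x) * u' t) atTop (nhds 0) := by
        refine squeeze_zero_norm' (a := fun t => 16 * N * exp (-(1 / 4) * |t|)) ?_
          (by
            simpa using (vanishes_exp_neg_mul_abs (k := 1 / 4) (by norm_num)).1.const_mul (16 * N))
        filter_upwards [eventually_ge_atTop x] with t ht
        have ht0 : 0 ≤ t := hx.trans ht
        rw [Real.norm_eq_abs, abs_mul, abs_of_nonneg (sub_nonneg.2 ht), abs_of_nonneg ht0]
        have h1 : t ≤ 4 * exp (1 / 4 * t) := by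
          have := add_one_le_exp (1 / 4 * t)
          linarith
        calc (t - x) * |u' t| ≤ (4 * exp (1 / 4 * t)) * (4 * N * exp (-(1 / 2) * t)) :=
              mul_le_mul (by linarith) (hdec t ht0) (abs_nonneg _) (by positivity)
          _ = 16 * N * (exp (1 / 4 * t) * exp (-(1 / 2) * t)) := by ring
          _ = _ := by rw [← exp_add]; ring_nf
      simpa using h0.sub e2
  have := abs_setIntegral_le_of_le_abs_mul hN0 hb
  rw [key] at this
  simpa using this

/-- Decaying solutions of `u'' = -k²u + f` are controlled by the source, uniformly in `k ≥ 0`. -/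
lemma abs_le_of_oscillating (hf : Continuous f) (hN : ∀ t, |f t| ≤ N * weight t) {k : ℝ}
    (hk : 0 ≤ k) (hu : ∀ x, HasDerivAt u (u' x) x)
    (hu' : ∀ x, HasDerivAt u' (-k ^ 2 * u x + f x) x) (h0 : Vanishes u) (h0' : Vanishes u')
    (x : ℝ) : |u x| ≤ 32 * N := by
  have right : ∀ {f u u' : ℝ → ℝ}, Continuous f → (∀ t, |f t| ≤ N * weight t) →
      (∀ x, HasDerivAt u (u' x) x) → (∀ x, HasDerivAt u' (-k ^ 2 * u x + f x) x) →
      Vanishes u → Vanishes u' → ∀ {x : ℝ}, 0 ≤ x → |u x| ≤ 32 * N := by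
    intro f u u' hf hN hu hu' h0 h0' x hx
    rcases hk.eq_or_lt with rfl | hk
    · exact abs_le_of_free_right hf hN hu (fun x => by simpa using hu' x) h0.1 h0'.1 hx
    · exact abs_le_of_oscillating_right hf hN hk hu hu' h0.1 h0'.1 hx
  rcases le_total 0 x with hx | hx
  · exact right hf hN hu hu' h0 h0' hx
  · have := right (f := fun t => f (-t)) (u := fun t => u (-t)) (u' := fun t => -1 * u' (-t))
      (by fun_prop) (fun t => by simpa [weight] using hN (-t))
      (fun t => ((hu (-t)).comp t (hasDerivAt_neg t)).congr_deriv (by ring))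
      (fun t => (((hu' (-t)).comp t (hasDerivAt_neg t)).const_mul (-1)).congr_deriv (by ring))
      h0.comp_neg (h0'.comp_neg.const_mul (-1)) (x := -x) (by linarith)
    simpa using this

end Oscillating

/-! ### The weakly coupled system -/

/-- `(u, v)` is a decaying solution of `u'' = a u + p u + q v`, `v'' = b v + q u + p v`, with
first derivatives `u'` and `v'`. -/
structure CoupledSolution (p q : ℝ → ℝ) (a b : ℝ) (u u' v v' : ℝ → ℝ) : Prop where
  deriv_u : ∀ x, HasDerivAt u (u' x) x
  deriv_u' : ∀ x, HasDerivAt u' (a * u x + (p x * u x + q x * v x)) x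
  deriv_v : ∀ x, HasDerivAt v (v' x) x
  deriv_v' : ∀ x, HasDerivAt v' (b * v x + (q x * u x + p x * v x)) x
  vanishes_u : Vanishes u
  vanishes_u' : Vanishes u'
  vanishes_v : Vanishes v
  vanishes_v' : Vanishes v'

lemma le_two_mul_of_halving {y : ℝ → ℝ} {c : ℝ} (hb : ∃ M, ∀ x, y x ≤ M)
    (h : ∀ M, (∀ x, y x ≤ M) → ∀ x, y x ≤ c + M / 2) (x : ℝ) : y x ≤ 2 * c := by
  obtain ⟨M, hM⟩ := hb
  have hbdd : BddAbove (Set.range y) := ⟨M, by rintro _ ⟨x, rfl⟩; exact hM x⟩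
  have h1 : ∀ x, y x ≤ ⨆ x, y x := le_ciSup hbdd
  have h2 : ⨆ x, y x ≤ c + (⨆ x, y x) / 2 := ciSup_le (h _ h1)
  linarith [h1 x]

lemma abs_coupling_le {η M t a b c d : ℝ} (ha : |a| ≤ η * weight t) (hb : |b| ≤ η * weight t)
    (hc : |c| ≤ M) (hd : |d| ≤ M) : |a * c + b * d| ≤ 2 * η * M * weight t := by
  refine (abs_add_le _ _).trans ?_
  rw [abs_mul, abs_mul]
  have h1 := mul_le_mul ha hc (abs_nonneg _) ((abs_nonneg _).trans ha)
  have h2 := mul_le_mul hb hd (abs_nonneg _) ((abs_nonneg _).trans hb)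
  linarith

namespace CoupledSolution

variable {p q u u' v v' : ℝ → ℝ} {a b η : ℝ}

lemma continuous_u (h : CoupledSolution p q a b u u' v v') : Continuous u :=
  continuous_iff_continuousAt.2 fun x => (h.deriv_u x).continuousAt

lemma continuous_v (h : CoupledSolution p q a b u u' v v') : Continuous v :=
  continuous_iff_continuousAt.2 fun x => (h.deriv_v x).continuousAt

lemma sub_mul {w w' z z' : ℝ → ℝ} (h : CoupledSolution p q a b u u' v v')
    (k : CoupledSolution p q a b w w' z z') (c : ℝ) :
    CoupledSolution p q a b (fun x => u x - c * w x) (fun x => u' x - c * w' x)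
      (fun x => v x - c * z x) (fun x => v' x - c * z' x) where
  deriv_u x := (h.deriv_u x).sub ((k.deriv_u x).const_mul c)
  deriv_u' x := ((h.deriv_u' x).sub ((k.deriv_u' x).const_mul c)).congr_deriv (by ring)
  deriv_v x := (h.deriv_v x).sub ((k.deriv_v x).const_mul c)
  deriv_v' x := ((h.deriv_v' x).sub ((k.deriv_v' x).const_mul c)).congr_deriv (by ring)
  vanishes_u := h.vanishes_u.sub (k.vanishes_u.const_mul c)
  vanishes_u' := h.vanishes_u'.sub (k.vanishes_u'.const_mul c)
  vanishes_v := h.vanishes_v.sub (k.vanishes_v.const_mul c)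
  vanishes_v' := h.vanishes_v'.sub (k.vanishes_v'.const_mul c)

lemma exists_bound (h : CoupledSolution p q a b u u' v v') :
    ∃ M, ∀ x, max |u x| |v x| ≤ M := by
  obtain ⟨M₁, h₁⟩ := h.vanishes_u.exists_bound h.continuous_u
  obtain ⟨M₂, h₂⟩ := h.vanishes_v.exists_bound h.continuous_v
  exact ⟨max M₁ M₂, fun x => max_le_max (h₁ x) (h₂ x)⟩

lemma abs_v_le (h : CoupledSolution p q a b u u' v v') (hp : Continuous p) (hq : Continuous q)
    (hpη : ∀ t, |p t| ≤ η * weight t) (hqη : ∀ t, |q t| ≤ η * weight t) {M : ℝ}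
    (hM : ∀ x, max |u x| |v x| ≤ M) (hb : 1 ≤ b) {k : ℝ} (hk : 0 ≤ k) (hk1 : k ≤ 1) (x : ℝ) :
    |v x| ≤ 4 * η * M * exp (-k * |x|) := by
  have hu := h.continuous_u
  have hv := h.continuous_v
  have hm1 : 1 ≤ √b := one_le_sqrt.2 hb
  have hN : ∀ t, |q t * u t + p t * v t| ≤ 2 * η * M * weight t := fun t =>
    abs_coupling_le (hqη t) (hpη t) ((le_max_left _ _).trans (hM t))
      ((le_max_right _ _).trans (hM t))
  have h1 := green_representation (f := fun t => q t * u t + p t * v t) (by fun_prop) hN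
    (k := √b) (by linarith) h.deriv_v (fun x => by
      rw [Real.sq_sqrt (by linarith)]; exact h.deriv_v' x)
    h.vanishes_v.1 h.vanishes_v'.1 h.vanishes_v.2 h.vanishes_v'.2 x
  have h2 := abs_integral_exp_mul_le hN hk hk1 (hk1.trans hm1) x
  rw [← abs_neg, ← h1, abs_mul, abs_of_pos (by linarith)] at h2
  nlinarith [abs_nonneg (v x)]

/-- There is no decaying solution at or above the threshold. -/
lemma eq_zero_of_nonpos (h : CoupledSolution p q a b u u' v v') (hp : Continuous p)
    (hq : Continuous q) (hpη : ∀ t, |p t| ≤ η * weight t) (hqη : ∀ t, |q t| ≤ η * weight t)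
    (hη : η ≤ 1 / 256) (ha : a ≤ 0) (hb : 1 ≤ b) : u = 0 ∧ v = 0 := by
  have hu := h.continuous_u
  have hv := h.continuous_v
  have key : ∀ x, max |u x| |v x| ≤ 2 * 0 := by
    refine le_two_mul_of_halving h.exists_bound fun M hM x => ?_
    have hM0 : 0 ≤ M := (abs_nonneg _).trans ((le_max_left _ _).trans (hM 0))
    have hN : ∀ t, |p t * u t + q t * v t| ≤ 2 * η * M * weight t := fun t =>
      abs_coupling_le (hpη t) (hqη t) ((le_max_left _ _).trans (hM t))
        ((le_max_right _ _).trans (hM t))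
    have h1 := abs_le_of_oscillating (f := fun t => p t * u t + q t * v t) (by fun_prop) hN
      (sqrt_nonneg (-a)) h.deriv_u (fun x => by
        rw [Real.sq_sqrt (by linarith), neg_neg]; exact h.deriv_u' x)
      h.vanishes_u h.vanishes_u' x
    have h2 := h.abs_v_le hp hq hpη hqη hM hb le_rfl zero_le_one x
    simp only [neg_zero, zero_mul, exp_zero, mul_one] at h2
    have h3 := mul_le_mul_of_nonneg_right hη hM0
    refine max_le ?_ ?_ <;> linarith
  constructor
  · ext x
    exact abs_nonpos_iff.1 (by linarith [(le_max_left _ _).trans (key x)])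
  · ext x
    exact abs_nonpos_iff.1 (by linarith [(le_max_right _ _).trans (key x)])

/-- Below the threshold, a decaying solution is close to a multiple of `(e^{-k|x|}, 0)`. -/
lemma exists_shape {k : ℝ} (hk : 0 < k) (hk1 : k ≤ 1)
    (h : CoupledSolution p q (k ^ 2) b u u' v v') (hp : Continuous p)
    (hq : Continuous q) (hpη : ∀ t, |p t| ≤ η * weight t) (hqη : ∀ t, |q t| ≤ η * weight t)
    (hη : η ≤ 1 / 256) (hb : 1 ≤ b) :
    ∃ A, ∀ x, |u x - A * exp (-k * |x|)| ≤ |A| / 4 * exp (-k * |x|) ∧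
      |v x| ≤ |A| / 4 * exp (-k * |x|) := by
  have hu := h.continuous_u
  have hv := h.continuous_v
  set A : ℝ := -(∫ t, p t * u t + q t * v t) / (2 * k) with hA
  have hbound : ∀ M, (∀ x, max |u x| |v x| ≤ M) →
      ∀ x, |u x - A * exp (-k * |x|)| ≤ 32 * η * M * exp (-k * |x|) := by
    intro M hM x
    have hN : ∀ t, |p t * u t + q t * v t| ≤ 2 * η * M * weight t := fun t =>
      abs_coupling_le (hpη t) (hqη t) ((le_max_left _ _).trans (hM t))
        ((le_max_right _ _).trans (hM t))
    have hc : Continuous fun t => p t * u t + q t * v t := by fun_prop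
    have h1 := green_representation hc hN hk h.deriv_u h.deriv_u'
      h.vanishes_u.1 h.vanishes_u'.1 h.vanishes_u.2 h.vanishes_u'.2 x
    have h2 := abs_integral_exp_sub_mul_le hN hk.le hk1 x
    have h3 : ∫ t, (exp (-k * |x - t|) - exp (-k * |x|)) * (p t * u t + q t * v t)
        = -(2 * k * (u x - A * exp (-k * |x|))) := by
      simp only [_root_.sub_mul]
      rw [integral_sub (integrable_exp_mul hc hN hk.le x)
        ((integrable_of_le_weight hc hN).const_mul _), integral_const_mul]
      have h4 : 2 * k * A = -∫ t, p t * u t + q t * v t := by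
        rw [hA]
        field_simp
      linear_combination h1 - exp (-k * |x|) * h4
    rw [h3, abs_neg, abs_mul, abs_of_pos (by linarith)] at h2
    have h4 : k * (2 * |u x - A * exp (-k * |x|)|) ≤ k * (64 * η * M * exp (-k * |x|)) := by
      linarith
    linarith [le_of_mul_le_mul_left h4 hk]
  have hle : ∀ x, exp (-k * |x|) ≤ 1 := fun x =>
    exp_le_one_iff.2 (by nlinarith [abs_nonneg x])
  have hη0 := nonneg_of_le_weight hpη
  have key : ∀ x, max |u x| |v x| ≤ 2 * |A| := by
    refine le_two_mul_of_halving h.exists_bound fun M hM x => ?_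
    have hM0 : 0 ≤ M := (abs_nonneg _).trans ((le_max_left _ _).trans (hM 0))
    have h1 := hbound M hM x
    have h2 := h.abs_v_le hp hq hpη hqη hM hb le_rfl zero_le_one x
    simp only [neg_zero, zero_mul, exp_zero, mul_one] at h2
    have h3 := mul_le_mul_of_nonneg_right hη hM0
    have h4 : 32 * η * M * exp (-k * |x|) ≤ 32 * η * M :=
      mul_le_of_le_one_right (by positivity) (hle x)
    have h5 : |A * exp (-k * |x|)| ≤ |A| := by
      rw [abs_mul, abs_of_pos (exp_pos _)]
      exact mul_le_of_le_one_right (abs_nonneg _) (hle x)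
    have h6 := abs_sub_abs_le_abs_sub (u x) (A * exp (-k * |x|))
    have := abs_nonneg A
    refine max_le ?_ ?_ <;> linarith
  refine ⟨A, fun x => ⟨?_, ?_⟩⟩
  · have h1 := hbound _ key x
    have h3 := mul_le_mul_of_nonneg_right hη (abs_nonneg A)
    have h4 := mul_le_mul_of_nonneg_right h3 (exp_pos (-k * |x|)).le
    linarith
  · have h1 := h.abs_v_le hp hq hpη hqη key hb hk.le hk1 x
    have h3 := mul_le_mul_of_nonneg_right hη (abs_nonneg A)
    have h4 := mul_le_mul_of_nonneg_right h3 (exp_pos (-k * |x|)).le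
    have : 0 ≤ |A| * exp (-k * |x|) := by positivity
    linarith

lemma eq_zero_of_apply_zero {k : ℝ} (hk : 0 < k) (hk1 : k ≤ 1)
    (h : CoupledSolution p q (k ^ 2) b u u' v v') (hp : Continuous p)
    (hq : Continuous q) (hpη : ∀ t, |p t| ≤ η * weight t) (hqη : ∀ t, |q t| ≤ η * weight t)
    (hη : η ≤ 1 / 256) (hb : 1 ≤ b) (h0 : u 0 = 0) : u = 0 ∧ v = 0 := by
  obtain ⟨A, hA⟩ := h.exists_shape hk hk1 hp hq hpη hqη hη hb
  have h1 := (hA 0).1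
  simp only [h0, abs_zero, mul_zero, exp_zero, mul_one, zero_sub, abs_neg] at h1
  have hA0 : A = 0 := abs_nonpos_iff.1 (by linarith [abs_nonneg A])
  simp only [hA0, abs_zero, zero_mul, zero_div, sub_zero, abs_nonpos_iff] at hA
  exact ⟨funext fun x => (hA x).1, funext fun x => (hA x).2⟩

lemma not_lt_of_apply_zero_ne {k l : ℝ} {w w' z z' : ℝ → ℝ} (hl : 0 < l) (hlk : l < k)
    (hk1 : k ≤ 1) (h : CoupledSolution p q (k ^ 2) (2 - k ^ 2) u u' v v')
    (g : CoupledSolution p q (l ^ 2) (2 - l ^ 2) w w' z z') (hp : Continuous p)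
    (hq : Continuous q) (hpη : ∀ t, |p t| ≤ η * weight t) (hqη : ∀ t, |q t| ≤ η * weight t)
    (hη : η ≤ 1 / 256) (hu0 : u 0 ≠ 0) (hw0 : w 0 ≠ 0) : False := by
  have hk : 0 < k := hl.trans hlk
  obtain ⟨A, hA⟩ := h.exists_shape hk hk1 hp hq hpη hqη hη (by nlinarith)
  obtain ⟨C, hC⟩ := g.exists_shape hl (by linarith) hp hq hpη hqη hη (by nlinarith)
  have hA0 : A ≠ 0 := by
    rintro rfl
    exact hu0 (by simpa using (hA 0).1)
  have hC0 : C ≠ 0 := by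
    rintro rfl
    exact hw0 (by simpa using (hC 0).1)
  have lower : ∀ {A y e : ℝ}, |y - A * e| ≤ |A| / 4 * e → 3 / 4 * A ^ 2 * e ≤ A * y := by
    intro A y e hy
    have h1 : |A * (y - A * e)| ≤ |A| * (|A| / 4 * e) := by
      rw [abs_mul]; exact mul_le_mul_of_nonneg_left hy (abs_nonneg A)
    have h2 := neg_le_of_abs_le h1
    have h3 : |A| * (|A| / 4 * e) = A ^ 2 / 4 * e := by rw [← sq_abs A]; ring
    rw [h3] at h2
    nlinarith
  have hpos : ∀ x, 0 < (k ^ 2 - l ^ 2) * (A * C * (u x * w x - v x * z x)) := by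
    intro x
    refine mul_pos (by nlinarith) ?_
    have e1 := exp_pos (-k * |x|)
    have e2 := exp_pos (-l * |x|)
    have hAu := lower (hA x).1
    have hCw := lower (hC x).1
    have h1 : 3 / 4 * A ^ 2 * exp (-k * |x|) * (3 / 4 * C ^ 2 * exp (-l * |x|))
        ≤ A * u x * (C * w x) :=
      mul_le_mul hAu hCw (by positivity) (le_trans (by positivity) hAu)
    have h2 : |A * v x * (C * z x)|
        ≤ |A| * (|A| / 4 * exp (-k * |x|)) * (|C| * (|C| / 4 * exp (-l * |x|))) := by
      rw [abs_mul, abs_mul, abs_mul]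
      gcongr
      · exact (hA x).2
      · exact (hC x).2
    have h3 : |A| * (|A| / 4 * exp (-k * |x|)) * (|C| * (|C| / 4 * exp (-l * |x|)))
        = 1 / 16 * (A ^ 2 * C ^ 2 * (exp (-k * |x|) * exp (-l * |x|))) := by
      rw [← sq_abs A, ← sq_abs C]; ring
    have h4 : 0 < A ^ 2 * C ^ 2 * (exp (-k * |x|) * exp (-l * |x|)) := by positivity
    have h5 := (le_abs_self _).trans (h2.trans h3.le)
    nlinarith
  set J : ℝ → ℝ := fun x =>
    A * C * (u' x * w x - u x * w' x + (v' x * z x - v x * z' x)) with hJ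
  have hd : ∀ x, HasDerivAt J ((k ^ 2 - l ^ 2) * (A * C * (u x * w x - v x * z x))) x := by
    intro x
    refine ((((h.deriv_u' x).mul (g.deriv_u x)).sub ((h.deriv_u x).mul (g.deriv_u' x))).add
      (((h.deriv_v' x).mul (g.deriv_v x)).sub
        ((h.deriv_v x).mul (g.deriv_v' x))) |>.const_mul (A * C)).congr_deriv ?_
    ring
  have hmono : StrictMono J := strictMono_of_deriv_pos fun x => by
    rw [(hd x).deriv]; exact hpos x
  have hlim : Vanishes J :=
    (((h.vanishes_u'.mul g.vanishes_u).sub (h.vanishes_u.mul g.vanishes_u')).add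
      ((h.vanishes_v'.mul g.vanishes_v).sub (h.vanishes_v.mul g.vanishes_v'))).const_mul (A * C)
  have h1 := hmono.monotone.ge_of_tendsto hlim.1 1
  have h2 := hmono.monotone.le_of_tendsto hlim.2 0
  have h3 := hmono (zero_lt_one (α := ℝ))
  linarith

/-- Two nontrivial decaying solutions below the threshold share their spectral parameter and
are proportional. -/
lemma eq_and_proportional {k l : ℝ} {w w' z z' : ℝ → ℝ} (hk : 0 < k) (hl : 0 < l) (hk1 : k ≤ 1)
    (hl1 : l ≤ 1) (h : CoupledSolution p q (k ^ 2) (2 - k ^ 2) u u' v v')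
    (g : CoupledSolution p q (l ^ 2) (2 - l ^ 2) w w' z z') (hp : Continuous p)
    (hq : Continuous q) (hpη : ∀ t, |p t| ≤ η * weight t) (hqη : ∀ t, |q t| ≤ η * weight t)
    (hη : η ≤ 1 / 256) (hw0 : w 0 ≠ 0) :
    (u = 0 ∧ v = 0) ∨
      (k = l ∧ ∃ c : ℝ, u = (fun x => c * w x) ∧ v = fun x => c * z x) := by
  by_cases hu0 : u 0 = 0
  · exact .inl (h.eq_zero_of_apply_zero hk hk1 hp hq hpη hqη hη (by nlinarith) hu0)
  have hkl : k = l := by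
    rcases lt_trichotomy k l with hlt | heq | hlt
    · exact (not_lt_of_apply_zero_ne hk hlt hl1 g h hp hq hpη hqη hη hw0 hu0).elim
    · exact heq
    · exact (not_lt_of_apply_zero_ne hl hlt hk1 h g hp hq hpη hqη hη hu0 hw0).elim
  subst hkl
  refine .inr ⟨rfl, u 0 / w 0, ?_⟩
  have h0 := (h.sub_mul g (u 0 / w 0)).eq_zero_of_apply_zero hk hk1 hp hq hpη hqη hη
    (by nlinarith) (by field_simp; ring)
  exact ⟨funext fun x => sub_eq_zero.1 (congrFun h0.1 x),
    funext fun x => sub_eq_zero.1 (congrFun h0.2 x)⟩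

end CoupledSolution

/-! ### Construction of a bound state of the weakly coupled system -/

section Construction

open BoundedContinuousFunction

variable {p q κ : ℝ → ℝ} {η : ℝ}

/-- The integral operator whose fixed points, for the values `κ τ` of the decay rate, are the
candidates for bound states of the coupled system. -/
noncomputable def couplingMap (p q κ : ℝ → ℝ) (U : ℝ × ℝ → ℝ × ℝ) (z : ℝ × ℝ) : ℝ × ℝ :=
  (exp (-κ z.1 * |z.2|) - 1 / (2 * κ z.1) * ∫ t, (exp (-κ z.1 * |z.2 - t|)
      - exp (-κ z.1 * |z.2|)) * (p t * (U (z.1, t)).1 + q t * (U (z.1, t)).2),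
    -(1 / (2 * √(2 - κ z.1 ^ 2)) * ∫ t, exp (-√(2 - κ z.1 ^ 2) * |z.2 - t|)
      * (q t * (U (z.1, t)).1 + p t * (U (z.1, t)).2)))

lemma abs_coupling_le_norm (hpη : ∀ t, |p t| ≤ η * weight t) (hqη : ∀ t, |q t| ≤ η * weight t)
    {M : ℝ} {U : ℝ × ℝ → ℝ × ℝ} (hM : ∀ z, ‖U z‖ ≤ M) (τ t : ℝ) :
    |p t * (U (τ, t)).1 + q t * (U (τ, t)).2| ≤ 2 * η * M * weight t :=
  abs_coupling_le (hpη t) (hqη t) ((norm_fst_le _).trans (hM _)) ((norm_snd_le _).trans (hM _))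

lemma one_le_sqrt_two_sub_sq {k : ℝ} (h0 : 0 < k) (h1 : k ≤ 1) : 1 ≤ √(2 - k ^ 2) :=
  one_le_sqrt.2 (by nlinarith)

lemma continuous_couplingMap (hp : Continuous p) (hq : Continuous q) (hκ : Continuous κ)
    (hκ0 : ∀ τ, 0 < κ τ) (hκ1 : ∀ τ, κ τ ≤ 1) (hpη : ∀ t, |p t| ≤ η * weight t)
    (hqη : ∀ t, |q t| ≤ η * weight t) {U : ℝ × ℝ → ℝ × ℝ} (hU : Continuous U) {M : ℝ}
    (hM : ∀ z, ‖U z‖ ≤ M) : Continuous (couplingMap p q κ U) := by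
  have hm : ∀ τ, 0 < √(2 - κ τ ^ 2) := fun τ =>
    one_pos.trans_le (one_le_sqrt_two_sub_sq (hκ0 τ) (hκ1 τ))
  have hle : ∀ {k : ℝ} (y : ℝ), 0 < k → exp (-k * |y|) ≤ 1 := fun {k} y hk =>
    exp_le_one_iff.2 (by nlinarith [abs_nonneg y])
  have hint : Integrable fun t => 2 * η * M * weight t := integrable_weight.const_mul _
  refine Continuous.prodMk ?_ ?_
  · refine Continuous.sub (by fun_prop) (Continuous.mul ?_ ?_)
    · exact continuous_const.div (by fun_prop) fun z => by have := hκ0 z.1; positivity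
    · refine continuous_of_dominated (bound := fun t => 2 * η * M * weight t)
        (fun z => Continuous.aestronglyMeasurable (by fun_prop))
        (fun z => Eventually.of_forall fun t => ?_) hint
        (Eventually.of_forall fun t => by fun_prop)
      rw [norm_mul]
      refine (mul_le_of_le_one_left (norm_nonneg _) ?_).trans
        (abs_coupling_le_norm hpη hqη hM z.1 t)
      rw [Real.norm_eq_abs, abs_le]
      have h1 := hle (z.2 - t) (hκ0 z.1)
      have h2 := hle z.2 (hκ0 z.1)
      have h3 := exp_pos (-κ z.1 * |z.2 - t|)
      have h4 := exp_pos (-κ z.1 * |z.2|)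
      constructor <;> linarith
  · refine Continuous.neg (Continuous.mul ?_ ?_)
    · exact continuous_const.div (by fun_prop) fun z => by have := hm z.1; positivity
    · refine continuous_of_dominated (bound := fun t => 2 * η * M * weight t)
        (fun z => Continuous.aestronglyMeasurable (by fun_prop))
        (fun z => Eventually.of_forall fun t => ?_) hint
        (Eventually.of_forall fun t => by fun_prop)
      rw [norm_mul]
      refine (mul_le_of_le_one_left (norm_nonneg _) ?_).trans
        (abs_coupling_le_norm hqη hpη hM z.1 t)
      rw [Real.norm_eq_abs, abs_of_pos (exp_pos _)]
      exact hle _ (hm z.1)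

lemma abs_fst_couplingMap_sub_le (hκ0 : ∀ τ, 0 < κ τ) (hκ1 : ∀ τ, κ τ ≤ 1)
    (hpη : ∀ t, |p t| ≤ η * weight t) (hqη : ∀ t, |q t| ≤ η * weight t)
    {U : ℝ × ℝ → ℝ × ℝ} {M : ℝ} (hM : ∀ z, ‖U z‖ ≤ M) (z : ℝ × ℝ) :
    |(couplingMap p q κ U z).1 - exp (-κ z.1 * |z.2|)| ≤ 32 * η * M := by
  have hk := hκ0 z.1
  have h1 := abs_integral_exp_sub_mul_le (fun t => abs_coupling_le_norm hpη hqη hM z.1 t)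
    hk.le (hκ1 z.1) z.2
  have hN := nonneg_of_le_weight fun t => abs_coupling_le_norm hpη hqη hM z.1 t
  have h2 : exp (-κ z.1 * |z.2|) ≤ 1 := exp_le_one_iff.2 (by nlinarith [abs_nonneg z.2])
  rw [couplingMap, sub_sub_cancel_left, abs_neg, abs_mul, abs_of_pos (by positivity),
    div_mul_eq_mul_div, one_mul, div_le_iff₀ (by positivity)]
  refine h1.trans ?_
  have h3 := mul_le_of_le_one_right hN h2
  nlinarith

lemma abs_snd_couplingMap_le (hκ0 : ∀ τ, 0 < κ τ) (hκ1 : ∀ τ, κ τ ≤ 1)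
    (hpη : ∀ t, |p t| ≤ η * weight t) (hqη : ∀ t, |q t| ≤ η * weight t)
    {U : ℝ × ℝ → ℝ × ℝ} {M : ℝ} (hM : ∀ z, ‖U z‖ ≤ M) (z : ℝ × ℝ) :
    |(couplingMap p q κ U z).2| ≤ 4 * η * M := by
  have hm := one_le_sqrt_two_sub_sq (hκ0 z.1) (hκ1 z.1)
  have h1 := abs_integral_exp_mul_le (fun t => abs_coupling_le_norm hqη hpη hM z.1 t)
    le_rfl zero_le_one (zero_le_one.trans hm) z.2
  have hN := nonneg_of_le_weight fun t => abs_coupling_le_norm hpη hqη hM z.1 t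
  simp only [neg_zero, zero_mul, exp_zero, mul_one] at h1
  rw [couplingMap, abs_neg, abs_mul, abs_of_pos (by positivity),
    div_mul_eq_mul_div, one_mul, div_le_iff₀ (by positivity)]
  refine h1.trans ?_
  nlinarith

lemma couplingMap_sub_sub (hp : Continuous p) (hq : Continuous q)
    (hκ0 : ∀ τ, 0 < κ τ) (hκ1 : ∀ τ, κ τ ≤ 1) (hpη : ∀ t, |p t| ≤ η * weight t)
    (hqη : ∀ t, |q t| ≤ η * weight t) {U V : ℝ × ℝ → ℝ × ℝ} (hU : Continuous U)
    (hV : Continuous V) {M : ℝ} (hMU : ∀ z, ‖U z‖ ≤ M) (hMV : ∀ z, ‖V z‖ ≤ M) (z : ℝ × ℝ) :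
    couplingMap p q κ (fun y => U y - V y) z
      = couplingMap p q κ U z - couplingMap p q κ V z + (exp (-κ z.1 * |z.2|), 0) := by
  have hm := one_le_sqrt_two_sub_sq (hκ0 z.1) (hκ1 z.1)
  have i1 : ∀ {W : ℝ × ℝ → ℝ × ℝ}, Continuous W → (∀ z, ‖W z‖ ≤ M) → Integrable fun t =>
      (exp (-κ z.1 * |z.2 - t|) - exp (-κ z.1 * |z.2|))
        * (p t * (W (z.1, t)).1 + q t * (W (z.1, t)).2) := by
    intro W hW hMW
    have hN := abs_coupling_le_norm hpη hqη hMW z.1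
    simp only [_root_.sub_mul]
    exact (integrable_exp_mul (by fun_prop) hN (hκ0 z.1).le z.2).sub
      ((integrable_of_le_weight (by fun_prop) hN).const_mul _)
  have i2 : ∀ {W : ℝ × ℝ → ℝ × ℝ}, Continuous W → (∀ z, ‖W z‖ ≤ M) → Integrable fun t =>
      exp (-√(2 - κ z.1 ^ 2) * |z.2 - t|)
        * (q t * (W (z.1, t)).1 + p t * (W (z.1, t)).2) := fun hW hMW =>
    integrable_exp_mul (by fun_prop) (abs_coupling_le_norm hqη hpη hMW z.1) (by linarith) z.2
  have e1 := integral_sub (i1 hU hMU) (i1 hV hMV)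
  have e2 := integral_sub (i2 hU hMU) (i2 hV hMV)
  have f1 : ∀ k a b c d x y : ℝ, k * (a * (x - y) + b * (c - d))
      = k * (a * x + b * c) - k * (a * y + b * d) := by intros; ring
  ext
  · simp only [couplingMap, Prod.fst_add, Prod.fst_sub, Prod.snd_sub, f1, e1]
    ring
  · simp only [couplingMap, Prod.snd_add, Prod.fst_sub, Prod.snd_sub, f1, e2]
    ring

lemma exists_eq_couplingMap (hp : Continuous p) (hq : Continuous q) (hκ : Continuous κ)
    (hκ0 : ∀ τ, 0 < κ τ) (hκ1 : ∀ τ, κ τ ≤ 1) (hpη : ∀ t, |p t| ≤ η * weight t)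
    (hqη : ∀ t, |q t| ≤ η * weight t) (hη : η ≤ 1 / 256) :
    ∃ U : ℝ × ℝ → ℝ × ℝ, Continuous U ∧ (∀ z, ‖U z‖ ≤ 2) ∧ ∀ z, couplingMap p q κ U z = U z := by
  have hη0 := nonneg_of_le_weight hpη
  have hle : ∀ z : ℝ × ℝ, |exp (-κ z.1 * |z.2|)| ≤ 1 := fun z => by
    rw [abs_of_pos (exp_pos _)]
    exact exp_le_one_iff.2 (by nlinarith [abs_nonneg z.2, hκ0 z.1])
  have hbound : ∀ {U : ℝ × ℝ → ℝ × ℝ} {M : ℝ}, (∀ z, ‖U z‖ ≤ M) →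
      ∀ z, ‖couplingMap p q κ U z‖ ≤ 1 + M / 2 := by
    intro U M hM z
    have hM0 : 0 ≤ M := (norm_nonneg _).trans (hM 0)
    have h3 := mul_le_mul_of_nonneg_right hη hM0
    have h1 := abs_fst_couplingMap_sub_le hκ0 hκ1 hpη hqη hM z
    have h2 := abs_snd_couplingMap_le hκ0 hκ1 hpη hqη hM z
    have h4 := abs_sub_abs_le_abs_sub (couplingMap p q κ U z).1 (exp (-κ z.1 * |z.2|))
    have h5 := hle z
    rw [Prod.norm_def, Real.norm_eq_abs, Real.norm_eq_abs]
    refine max_le ?_ ?_ <;> linarith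
  let T : (ℝ × ℝ →ᵇ ℝ × ℝ) → (ℝ × ℝ →ᵇ ℝ × ℝ) := fun U =>
    ofNormedAddCommGroup (couplingMap p q κ U)
      (continuous_couplingMap hp hq hκ hκ0 hκ1 hpη hqη U.continuous U.norm_coe_le_norm)
      (1 + ‖U‖ / 2) (hbound U.norm_coe_le_norm)
  have hT : ContractingWith (1 / 2) T := by
    refine ⟨by rw [← NNReal.coe_lt_coe]; norm_num, LipschitzWith.of_dist_le_mul fun U V => ?_⟩
    refine (dist_le (by positivity)).2 fun z => ?_
    have hUV : ∀ z, ‖U z - V z‖ ≤ dist U V := fun z => by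
      rw [← dist_eq_norm]; exact dist_coe_le_dist z
    have e := couplingMap_sub_sub hp hq hκ0 hκ1 hpη hqη U.continuous V.continuous
      (fun z => (U.norm_coe_le_norm z).trans (le_max_left ‖U‖ ‖V‖))
      (fun z => (V.norm_coe_le_norm z).trans (le_max_right ‖U‖ ‖V‖)) z
    have h1 := abs_fst_couplingMap_sub_le hκ0 hκ1 hpη hqη hUV z
    have h2 := abs_snd_couplingMap_le hκ0 hκ1 hpη hqη hUV z
    have h3 := mul_le_mul_of_nonneg_right hη (dist_nonneg (x := U) (y := V))
    have h0 := dist_nonneg (x := U) (y := V)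
    rw [e] at h1 h2
    simp only [Prod.fst_add, Prod.snd_add, add_sub_cancel_right, add_zero] at h1 h2
    rw [dist_eq_norm]
    change ‖couplingMap p q κ U z - couplingMap p q κ V z‖ ≤ _
    rw [Prod.norm_def, Real.norm_eq_abs, Real.norm_eq_abs]
    push_cast
    refine max_le ?_ ?_ <;> linarith
  have hfix : T (hT.fixedPoint T) = hT.fixedPoint T := hT.fixedPoint_isFixedPt
  set U := hT.fixedPoint T
  have hU : ∀ z, couplingMap p q κ U z = U z := fun z => congrArg (fun F => F z) hfix
  refine ⟨U, U.continuous, ?_, hU⟩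
  have := le_two_mul_of_halving (y := fun s : ℝ => ‖U‖) (c := 1) ⟨‖U‖, fun _ => le_rfl⟩
    (fun M hM x => (norm_le (by linarith [(norm_nonneg U).trans (hM 0)])).2 fun z => by
      rw [← hU]
      exact hbound (fun z => (U.norm_coe_le_norm z).trans (hM 0)) z) 0
  exact fun z => (U.norm_coe_le_norm z).trans (by simpa using this)

end Construction

section Construction

variable {p q : ℝ → ℝ} {η : ℝ}

lemma abs_exp_neg_mul_abs_sub_one_le {k : ℝ} (hk : 0 ≤ k) (x : ℝ) :
    |exp (-k * |x|) - 1| ≤ k * |x| := by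
  have h0 : 0 ≤ k * |x| := by positivity
  have h1 := add_one_le_exp (-k * |x|)
  have h2 : exp (-k * |x|) ≤ 1 := exp_le_one_iff.2 (by linarith)
  rw [abs_le]
  constructor <;> linarith

/-- If `k` is small, the averaged coupling of a fixed point is close to `∫ p`. -/
lemma integral_coupling_le (hp : Continuous p) (hq : Continuous q)
    (hpη : ∀ t, |p t| ≤ η * weight t) (hqη : ∀ t, |q t| ≤ η * weight t) {u v : ℝ → ℝ}
    (hu : Continuous u) (hv : Continuous v) {k A : ℝ} (hk : 0 ≤ k) (hA : 0 ≤ A)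
    (huA : ∀ t, |u t - exp (-k * |t|)| ≤ A) (hvA : ∀ t, |v t| ≤ A) :
    ∫ t, (p t * u t + q t * v t) ≤ (∫ t, p t) + η * (4 * A + 32 * k) := by
  have hη0 := nonneg_of_le_weight hpη
  have hi : Integrable fun t : ℝ => η * (2 * A) * weight t + η * k * 4 * exp (-(1 / 4) * |t|) :=
    (integrable_weight.const_mul _).add
      ((integrable_exp_neg_mul_abs' (by norm_num)).const_mul _)
  have hip := integrable_of_le_weight hp hpη
  have hle : ∀ t, p t * u t + q t * v t
      ≤ p t + (η * (2 * A) * weight t + η * k * 4 * exp (-(1 / 4) * |t|)) := by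
    intro t
    have h1 : |u t - 1| ≤ A + k * |t| := by
      have := abs_add_le (u t - exp (-k * |t|)) (exp (-k * |t|) - 1)
      rw [sub_add_sub_cancel] at this
      linarith [huA t, abs_exp_neg_mul_abs_sub_one_le hk t]
    have h2 : |p t * (u t - 1)| ≤ (η * weight t) * (A + k * |t|) := by
      rw [abs_mul]
      exact mul_le_mul (hpη t) h1 (abs_nonneg _) ((abs_nonneg _).trans (hpη t))
    have h3 : |q t * v t| ≤ (η * weight t) * A := by
      rw [abs_mul]
      exact mul_le_mul (hqη t) (hvA t) (abs_nonneg _) ((abs_nonneg _).trans (hqη t))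
    have h4 : η * k * (|t| * weight t) ≤ η * k * (4 * exp (-(1 / 4) * |t|)) :=
      mul_le_mul_of_nonneg_left (abs_mul_weight_le t) (by positivity)
    have h5 := le_abs_self (p t * (u t - 1))
    have h6 := le_abs_self (q t * v t)
    linarith
  have hif : Integrable fun t => p t * u t + q t * v t := by
    refine (hip.norm.add hi).mono' (by fun_prop) (Eventually.of_forall fun t => ?_)
    have h1 : |u t| ≤ A + 1 := by
      have h := abs_add_le (u t - exp (-k * |t|)) (exp (-k * |t|))
      rw [sub_add_cancel, abs_of_pos (exp_pos (-k * |t|))] at h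
      have h2 : exp (-k * |t|) ≤ 1 := exp_le_one_iff.2 (by nlinarith [abs_nonneg t])
      linarith [huA t]
    have h2 : |p t * u t| ≤ |p t| + (η * weight t) * A := by
      rw [abs_mul]
      have := mul_le_mul_of_nonneg_left h1 (abs_nonneg (p t))
      have := mul_le_mul_of_nonneg_right (hpη t) hA
      linarith
    have h3 : |q t * v t| ≤ (η * weight t) * A := by
      rw [abs_mul]
      exact mul_le_mul (hqη t) (hvA t) (abs_nonneg _) ((abs_nonneg _).trans (hqη t))
    have h4 : 0 ≤ η * k * 4 * exp (-(1 / 4) * |t|) := by positivity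
    have h5 := abs_add_le (p t * u t) (q t * v t)
    simp only [Real.norm_eq_abs, Pi.add_apply]
    linarith
  have h1 := integral_mono hif (hip.add hi) hle
  rw [integral_add' hip hi] at h1
  rw [integral_add (integrable_weight.const_mul _)
    ((integrable_exp_neg_mul_abs' (by norm_num)).const_mul _), integral_const_mul,
    integral_const_mul, integral_weight, integral_exp_neg_mul_abs' (by norm_num)] at h1
  have : 0 ≤ η * A := by positivity
  linarith

/-- If `∫ p` is sufficiently negative, the coupled system has a bound state with small decay
rate. -/
theorem exists_coupledSolution (hp : Continuous p) (hq : Continuous q)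
    (hpη : ∀ t, |p t| ≤ η * weight t) (hqη : ∀ t, |q t| ≤ η * weight t) (hη0 : 0 < η)
    (hη : η ≤ 1 / 256) (hneg : ∫ t, p t ≤ -(400 * η ^ 2)) :
    ∃ (k M : ℝ) (u u' v v' : ℝ → ℝ), 0 < k ∧ k ≤ 3 * η ∧
      CoupledSolution p q (k ^ 2) (2 - k ^ 2) u u' v v' ∧ u 0 ≠ 0 ∧
      ∀ x, |u x| ≤ M * exp (-k * |x|) ∧ |u' x| ≤ M * exp (-k * |x|) ∧
        |v x| ≤ M * exp (-k * |x|) ∧ |v' x| ≤ M * exp (-k * |x|) := by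
  have hη2 : η ^ 2 ≤ 1 := by nlinarith
  set κ : ℝ → ℝ := fun τ => max (η ^ 2) (min τ 1) with hκdef
  have hκ : Continuous κ := by fun_prop
  have hκ0 : ∀ τ, 0 < κ τ := fun τ => lt_of_lt_of_le (by positivity) (le_max_left _ _)
  have hκ1 : ∀ τ, κ τ ≤ 1 := fun τ => max_le hη2 (min_le_right _ _)
  obtain ⟨U, hUc, hU2, hU⟩ := exists_eq_couplingMap hp hq hκ hκ0 hκ1 hpη hqη hη
  set f : ℝ → ℝ → ℝ := fun τ t => p t * (U (τ, t)).1 + q t * (U (τ, t)).2 with hf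
  have hfN : ∀ τ t, |f τ t| ≤ 2 * η * 2 * weight t := fun τ => abs_coupling_le_norm hpη hqη hU2 τ
  have hfc : ∀ τ, Continuous (f τ) := fun τ => by fun_prop
  have hΦ : Continuous fun τ => κ τ + 1 / 2 * ∫ t, f τ t := by
    refine hκ.add (continuous_const.mul (continuous_of_dominated
      (bound := fun t => 2 * η * 2 * weight t)
      (fun τ => (hfc τ).aestronglyMeasurable) (fun τ => Eventually.of_forall (hfN τ))
      (integrable_weight.const_mul _) (Eventually.of_forall fun t => by fun_prop)))
  have hA1 : ∀ τ t, |(U (τ, t)).1 - exp (-κ τ * |t|)| ≤ 64 * η := fun τ t => by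
    have := abs_fst_couplingMap_sub_le hκ0 hκ1 hpη hqη hU2 (τ, t)
    rw [hU] at this
    linarith
  have hA2 : ∀ τ t, |(U (τ, t)).2| ≤ 64 * η := fun τ t => by
    have := abs_snd_couplingMap_le hκ0 hκ1 hpη hqη hU2 (τ, t)
    rw [hU] at this
    linarith
  have hint : ∀ τ, |∫ t, f τ t| ≤ 4 / 3 * (2 * η * 2) := fun τ =>
    abs_integral_le_of_le_weight (hfN τ)
  have hlow : κ (η ^ 2) + 1 / 2 * ∫ t, f (η ^ 2) t ≤ 0 := by
    have e : κ (η ^ 2) = η ^ 2 := by simp [hκdef, hη2]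
    have := integral_coupling_le hp hq hpη hqη (u := fun t => (U (η ^ 2, t)).1)
      (v := fun t => (U (η ^ 2, t)).2) (by fun_prop) (by fun_prop) (hκ0 (η ^ 2)).le
      (by positivity) (hA1 _) (hA2 _)
    simp only [e] at this ⊢
    change ∫ t, f (η ^ 2) t ≤ _ at this
    nlinarith
  have hhigh : 0 ≤ κ 1 + 1 / 2 * ∫ t, f 1 t := by
    have e : κ 1 = 1 := by simp [hκdef, hη2]
    have := neg_le_of_abs_le (hint 1)
    rw [e]
    linarith
  obtain ⟨τ, -, hτ⟩ := intermediate_value_Icc hη2 hΦ.continuousOn ⟨hlow, hhigh⟩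
  have hk := hκ0 τ
  have hk1 := hκ1 τ
  have hm := one_le_sqrt_two_sub_sq hk hk1
  have hτ : 2 * κ τ = -∫ t, f τ t := by
    simp only at hτ
    linarith
  have hku : ∀ x, 2 * κ τ * (U (τ, x)).1 = -∫ t, exp (-κ τ * |x - t|) * f τ t := by
    intro x
    have h1 := congrArg Prod.fst (hU (τ, x))
    have h2 : ∫ t, (exp (-κ τ * |x - t|) - exp (-κ τ * |x|)) * f τ t
        = (∫ t, exp (-κ τ * |x - t|) * f τ t) - exp (-κ τ * |x|) * ∫ t, f τ t := by
      simp only [_root_.sub_mul]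
      rw [integral_sub (integrable_exp_mul (hfc τ) (hfN τ) hk.le x)
        ((integrable_of_le_weight (hfc τ) (hfN τ)).const_mul _), integral_const_mul]
    simp only [couplingMap] at h1
    change exp (-κ τ * |x|) - 1 / (2 * κ τ)
      * ∫ t, (exp (-κ τ * |x - t|) - exp (-κ τ * |x|)) * f τ t = _ at h1
    rw [h2] at h1
    rw [← h1]
    field_simp
    linear_combination exp (-(κ τ * |x|)) * hτ
  have hkv : ∀ x, 2 * √(2 - κ τ ^ 2) * (U (τ, x)).2
      = -∫ t, exp (-√(2 - κ τ ^ 2) * |x - t|) * (q t * (U (τ, t)).1 + p t * (U (τ, t)).2) := by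
    intro x
    have h1 := congrArg Prod.snd (hU (τ, x))
    simp only [couplingMap] at h1
    rw [← h1]
    field_simp
  have hgN := abs_coupling_le_norm hqη hpη hU2 τ
  have hgc : Continuous fun t => q t * (U (τ, t)).1 + p t * (U (τ, t)).2 := by fun_prop
  obtain ⟨u', hu, hu', hub⟩ := green_solution (hfc τ) (hfN τ) hk hku
  obtain ⟨v', hv, hv', hvb⟩ := green_solution hgc hgN (zero_lt_one.trans_le hm) hkv
  have hub := hub (κ τ) hk.le hk1 le_rfl
  have hvb := hvb (κ τ) hk.le hk1 (hk1.trans hm)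
  have hub0 : ∀ x, |(U (τ, x)).1| ≤ 1 / κ τ * exp (-κ τ * |x|) := fun x => by
    have h := abs_integral_exp_mul_le (hfN τ) hk.le hk1 le_rfl x
    rw [← abs_neg, ← hku, abs_mul, abs_of_pos (by linarith)] at h
    rw [div_mul_eq_mul_div, le_div_iff₀ hk]
    have := exp_pos (-κ τ * |x|)
    nlinarith
  have hvb0 : ∀ x, |(U (τ, x)).2| ≤ 1 / κ τ * exp (-κ τ * |x|) := fun x => by
    have h := abs_integral_exp_mul_le hgN hk.le hk1 (hk1.trans hm) x
    rw [← abs_neg, ← hkv, abs_mul, abs_of_pos (by linarith)] at h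
    rw [div_mul_eq_mul_div, le_div_iff₀ hk]
    have := exp_pos (-κ τ * |x|)
    have := abs_nonneg (U (τ, x)).2
    nlinarith
  have hM : ∀ y x : ℝ, y ≤ 2 * (2 * η * 2) * exp (-κ τ * |x|) →
      y ≤ 1 / κ τ * exp (-κ τ * |x|) := fun y x hy => by
    refine hy.trans (mul_le_mul_of_nonneg_right ?_ (exp_pos _).le)
    have : 1 ≤ 1 / κ τ := by rwa [le_div_iff₀ hk, one_mul]
    linarith
  refine ⟨κ τ, 1 / κ τ, fun x => (U (τ, x)).1, u', fun x => (U (τ, x)).2, v', hk, ?_,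
    ⟨hu, hu', hv, fun x => ?_, vanishes_of_le_exp hk hub0, vanishes_of_le_exp hk hub,
      vanishes_of_le_exp hk hvb0, vanishes_of_le_exp hk hvb⟩, ?_, fun x =>
    ⟨hub0 x, hM _ _ (hub x), hvb0 x, hM _ _ (hvb x)⟩⟩
  · have := neg_le_of_abs_le (hint τ)
    linarith
  · have := hv' x
    rwa [Real.sq_sqrt (by nlinarith)] at this
  · have := hA1 τ 0
    rw [abs_zero, mul_zero, exp_zero] at this
    have := neg_le_of_abs_le this
    have h : 0 < (U (τ, 0)).1 := by linarith
    exact h.ne'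

end Construction

/-! ### The rescaled solitary wave -/

/-- `Q` is a positive even solution of `Q'' = Q - Q³ - Q h(Q²)` vanishing at infinity, where
`h` is a perturbation of size `ε`, with derivative `h'` and antiderivative `H`. -/
structure ScaledWave (h h' H Q Q' : ℝ → ℝ) (ε : ℝ) : Prop where
  pos : ∀ x, 0 < Q x
  even : ∀ x, Q (-x) = Q x
  deriv_Q : ∀ x, HasDerivAt Q (Q' x) x
  deriv_Q' : ∀ x, HasDerivAt Q' (Q x - Q x ^ 3 - Q x * h (Q x ^ 2)) x
  vanishes : Vanishes Q
  deriv_h : ∀ s, 0 < s → HasDerivAt h (h' s) s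
  deriv_H : ∀ s, 0 < s → HasDerivAt H (h s) s
  continuousOn_h' : ContinuousOn h' (Set.Ioi 0)
  abs_h_le : ∀ s, 0 < s → s ≤ 3 → |h s| ≤ ε * s
  abs_h'_le : ∀ s, 0 < s → s ≤ 3 → |h' s| ≤ ε
  abs_H_le : ∀ s, 0 < s → s ≤ 3 → |H s| ≤ ε * s ^ 2 / 2
  le_eps : ε ≤ 1 / 15

namespace ScaledWave

variable {h h' H Q Q' : ℝ → ℝ} {ε : ℝ}

lemma eps_nonneg (w : ScaledWave h h' H Q Q' ε) : 0 ≤ ε :=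
  (abs_nonneg _).trans (w.abs_h'_le 1 one_pos (by norm_num))

lemma sq_pos (w : ScaledWave h h' H Q Q' ε) (x : ℝ) : 0 < Q x ^ 2 := pow_pos (w.pos x) 2

lemma continuous_Q (w : ScaledWave h h' H Q Q' ε) : Continuous Q :=
  continuous_iff_continuousAt.2 fun x => (w.deriv_Q x).continuousAt

lemma hasDerivAt_sq (w : ScaledWave h h' H Q Q' ε) (x : ℝ) :
    HasDerivAt (fun x => Q x ^ 2) (2 * Q x * Q' x) x :=
  ((w.deriv_Q x).fun_pow 2).congr_deriv (by ring)

/-- Conservation of energy. -/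
lemma energy_eq (w : ScaledWave h h' H Q Q' ε) (x : ℝ) :
    Q' x ^ 2 = Q x ^ 2 - Q x ^ 4 / 2 - H (Q x ^ 2) := by
  set E : ℝ → ℝ := fun x => Q' x ^ 2 - Q x ^ 2 + (Q x ^ 2) ^ 2 / 2 + H (Q x ^ 2) with hE
  have hd : ∀ x, HasDerivAt E 0 x := fun x => by
    have hs := w.hasDerivAt_sq x
    refine (((((w.deriv_Q' x).fun_pow 2).sub hs).add ((hs.fun_pow 2).div_const 2)).add
      ((w.deriv_H _ (w.sq_pos x)).comp x hs)).congr_deriv ?_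
    ring
  have hconst : ∀ x y, E x = E y := is_const_of_deriv_eq_zero
    (fun x => (hd x).differentiableAt) fun x => (hd x).deriv
  have hmvt : ∀ n : ℕ, ∃ ξ : ℝ, (n : ℝ) ≤ ξ ∧ Q' ξ = Q (n + 1) - Q n := fun n => by
    obtain ⟨ξ, hξ, e⟩ := exists_hasDerivAt_eq_slope Q Q' (a := n) (b := n + 1) (by linarith)
      w.continuous_Q.continuousOn fun x _ => w.deriv_Q x
    exact ⟨ξ, hξ.1.le, by rw [e]; simp⟩
  choose ξ hξ hQξ using hmvt
  have hn : Tendsto (fun n : ℕ => (n : ℝ)) atTop atTop := tendsto_natCast_atTop_atTop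
  have hξt : Tendsto ξ atTop atTop := tendsto_atTop_mono hξ hn
  have h1 : Tendsto (fun n => Q' (ξ n)) atTop (nhds 0) := by
    simp only [hQξ]
    simpa using (w.vanishes.1.comp (tendsto_atTop_add_const_right _ 1 hn)).sub
      (w.vanishes.1.comp hn)
  have h2 : Tendsto (fun n => Q (ξ n) ^ 2) atTop (nhds 0) := by
    simpa using (w.vanishes.1.comp hξt).pow 2
  have h3 : Tendsto (fun n => H (Q (ξ n) ^ 2)) atTop (nhds 0) := by
    refine squeeze_zero_norm' (a := fun n => ε * (Q (ξ n) ^ 2) ^ 2 / 2) ?_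
      (by simpa using ((h2.pow 2).const_mul ε).div_const 2)
    filter_upwards [h2.eventually_le_const (show (0 : ℝ) < 3 by norm_num)] with n hn
    exact w.abs_H_le _ (w.sq_pos _) hn
  have h4 : Tendsto (fun n => E (ξ n)) atTop (nhds 0) := by
    simpa [hE] using (((h1.pow 2).sub h2).add ((h2.pow 2).div_const 2)).add h3
  have h5 : E x = 0 := tendsto_nhds_unique
    (tendsto_const_nhds.congr fun n => hconst x (ξ n)) h4
  simp only [hE] at h5
  linarith

lemma sq_le (w : ScaledWave h h' H Q Q' ε) (x : ℝ) : Q x ^ 2 ≤ 3 := by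
  by_contra! hx
  have hs : Tendsto (fun x => Q x ^ 2) atTop (nhds 0) := by simpa using w.vanishes.1.pow 2
  obtain ⟨y, hy⟩ := (hs.eventually_le_const (show (0 : ℝ) < 3 by norm_num)).exists
  obtain ⟨z, hz⟩ := mem_range_of_exists_le_of_exists_ge (w.continuous_Q.pow 2)
    ⟨y, hy⟩ ⟨x, hx.le⟩
  have h1 := w.energy_eq z
  have h2 : Q z ^ 4 = (Q z ^ 2) ^ 2 := by ring
  have hz : Q z ^ 2 = 3 := hz
  rw [h2, hz] at h1
  have h3 := neg_le_of_abs_le (w.abs_H_le 3 (by norm_num) le_rfl)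
  have := w.le_eps
  have := sq_nonneg (Q' z)
  linarith

lemma deriv_zero (w : ScaledWave h h' H Q Q' ε) : Q' 0 = 0 := by
  have h1 : HasDerivAt (fun x => Q (-x)) (Q' (-0) * (-1)) 0 :=
    (w.deriv_Q (-0)).comp 0 (hasDerivAt_neg 0)
  simp only [w.even, neg_zero] at h1
  linarith [h1.unique (w.deriv_Q 0)]

/-- The logarithmic derivative of the wave. -/
noncomputable def logDeriv (Q Q' : ℝ → ℝ) (x : ℝ) : ℝ := Q' x / Q x

/-- The derivative of the logarithmic derivative of the wave. -/
noncomputable def logDeriv' (h H Q : ℝ → ℝ) (x : ℝ) : ℝ :=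
  -(Q x ^ 2) / 2 - h (Q x ^ 2) + H (Q x ^ 2) / Q x ^ 2

/-- The potential of the linearized operator `𝓛₊`, including the constant `1`. -/
noncomputable def potential (h h' Q : ℝ → ℝ) (x : ℝ) : ℝ :=
  1 - 3 * Q x ^ 2 - h (Q x ^ 2) - 2 * Q x ^ 2 * h' (Q x ^ 2)

lemma Q'_eq (w : ScaledWave h h' H Q Q' ε) (x : ℝ) : Q' x = logDeriv Q Q' x * Q x :=
  (div_mul_cancel₀ _ (w.pos x).ne').symm

lemma logDeriv_sq (w : ScaledWave h h' H Q Q' ε) (x : ℝ) :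
    logDeriv Q Q' x ^ 2 = 1 - Q x ^ 2 / 2 - H (Q x ^ 2) / Q x ^ 2 := by
  have := (w.pos x).ne'
  rw [logDeriv, div_pow, w.energy_eq]
  field_simp

lemma logDeriv_sq_add (w : ScaledWave h h' H Q Q' ε) (x : ℝ) :
    logDeriv Q Q' x ^ 2 + logDeriv' h H Q x = 1 - Q x ^ 2 - h (Q x ^ 2) := by
  rw [w.logDeriv_sq, logDeriv']
  ring

lemma hasDerivAt_logDeriv (w : ScaledWave h h' H Q Q' ε) (x : ℝ) :
    HasDerivAt (logDeriv Q Q') (logDeriv' h H Q x) x := by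
  have h0 := (w.pos x).ne'
  refine ((w.deriv_Q' x).div (w.deriv_Q x) h0).congr_deriv ?_
  have h1 := w.logDeriv_sq_add x
  rw [logDeriv, div_pow] at h1
  rw [eq_sub_of_add_eq' h1]
  field_simp

lemma hasDerivAt_H_div (w : ScaledWave h h' H Q Q' ε) (x : ℝ) :
    HasDerivAt (fun x => H (Q x ^ 2) / Q x ^ 2)
      (2 * logDeriv Q Q' x * (h (Q x ^ 2) - H (Q x ^ 2) / Q x ^ 2)) x := by
  have h0 := (w.pos x).ne'
  have hs := w.hasDerivAt_sq x
  refine (((w.deriv_H _ (w.sq_pos x)).comp x hs).div hs (w.sq_pos x).ne').congr_deriv ?_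
  simp only [Function.comp_apply]
  rw [w.Q'_eq]
  field_simp

lemma hasDerivAt_logDeriv' (w : ScaledWave h h' H Q Q' ε) (x : ℝ) :
    HasDerivAt (logDeriv' h H Q) (potential h h' Q x * logDeriv Q Q' x
      - 3 * logDeriv Q Q' x * logDeriv' h H Q x - logDeriv Q Q' x ^ 3) x := by
  have hs := w.hasDerivAt_sq x
  refine (((hs.neg.div_const 2).sub ((w.deriv_h _ (w.sq_pos x)).comp x hs)).add
    (w.hasDerivAt_H_div x)).congr_deriv ?_
  have h1 : logDeriv Q Q' x ^ 3 = logDeriv Q Q' x ^ 2 * logDeriv Q Q' x := by ring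
  rw [h1, w.logDeriv_sq, w.Q'_eq, potential, logDeriv']
  ring

lemma abs_H_div_le (w : ScaledWave h h' H Q Q' ε) (x : ℝ) :
    |H (Q x ^ 2) / Q x ^ 2| ≤ ε * Q x ^ 2 / 2 := by
  rw [abs_div, abs_of_pos (w.sq_pos x), div_le_iff₀ (w.sq_pos x)]
  linarith [w.abs_H_le _ (w.sq_pos x) (w.sq_le x)]

lemma abs_sq_mul_h'_le (w : ScaledWave h h' H Q Q' ε) (x : ℝ) :
    |Q x ^ 2 * h' (Q x ^ 2)| ≤ ε * Q x ^ 2 := by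
  rw [abs_mul, abs_of_pos (w.sq_pos x), mul_comm ε]
  exact mul_le_mul_of_nonneg_left (w.abs_h'_le _ (w.sq_pos x) (w.sq_le x)) (w.sq_pos x).le

lemma eps_mul_sq_le (w : ScaledWave h h' H Q Q' ε) (x : ℝ) : ε * Q x ^ 2 ≤ 1 / 15 * Q x ^ 2 :=
  mul_le_mul_of_nonneg_right w.le_eps (w.sq_pos x).le

lemma logDeriv_sq_lt (w : ScaledWave h h' H Q Q' ε) (x : ℝ) :
    2 / 5 * Q x ^ 2 ≤ 1 - logDeriv Q Q' x ^ 2 := by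
  rw [w.logDeriv_sq]
  have := neg_le_of_abs_le (w.abs_H_div_le x)
  have := w.eps_mul_sq_le x
  have := w.sq_pos x
  linarith

lemma abs_logDeriv_lt (w : ScaledWave h h' H Q Q' ε) (x : ℝ) : |logDeriv Q Q' x| < 1 := by
  rw [← sq_lt_one_iff_abs_lt_one]
  linarith [w.logDeriv_sq_lt x, w.sq_pos x]

lemma logDeriv'_neg (w : ScaledWave h h' H Q Q' ε) (x : ℝ) : logDeriv' h H Q x < 0 := by
  rw [logDeriv']
  have := le_of_abs_le (w.abs_H_div_le x)
  have := neg_le_of_abs_le (w.abs_h_le _ (w.sq_pos x) (w.sq_le x))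
  have := w.eps_mul_sq_le x
  have := w.sq_pos x
  linarith

lemma logDeriv'_le (w : ScaledWave h h' H Q Q' ε) (x : ℝ) :
    2 * logDeriv' h H Q x ≤ -(3 / 2) * (1 - logDeriv Q Q' x ^ 2) := by
  rw [logDeriv', w.logDeriv_sq]
  have := le_of_abs_le (w.abs_H_div_le x)
  have := neg_le_of_abs_le (w.abs_h_le _ (w.sq_pos x) (w.sq_le x))
  have := w.eps_mul_sq_le x
  have := w.sq_pos x
  linarith

lemma abs_logDeriv'_le (w : ScaledWave h h' H Q Q' ε) (x : ℝ) : |logDeriv' h H Q x| ≤ 3 := by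
  rw [abs_of_neg (w.logDeriv'_neg x), logDeriv']
  have := neg_le_of_abs_le (w.abs_H_div_le x)
  have := le_of_abs_le (w.abs_h_le _ (w.sq_pos x) (w.sq_le x))
  have := w.eps_mul_sq_le x
  have := w.sq_le x
  linarith

lemma abs_potential_le (w : ScaledWave h h' H Q Q' ε) (x : ℝ) : |potential h h' Q x| ≤ 11 := by
  have h1 := abs_le.1 (w.abs_h_le _ (w.sq_pos x) (w.sq_le x))
  have h2 := abs_le.1 (w.abs_sq_mul_h'_le x)
  have := w.eps_mul_sq_le x
  have := w.sq_le x
  have := w.sq_pos x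
  rw [potential, abs_le]
  constructor <;> linarith

lemma continuous_h_sq (w : ScaledWave h h' H Q Q' ε) : Continuous fun x => h (Q x ^ 2) :=
  continuous_iff_continuousAt.2 fun x =>
    ((w.deriv_h _ (w.sq_pos x)).comp x (w.hasDerivAt_sq x)).continuousAt

lemma continuous_H_div (w : ScaledWave h h' H Q Q' ε) :
    Continuous fun x => H (Q x ^ 2) / Q x ^ 2 :=
  continuous_iff_continuousAt.2 fun x => (w.hasDerivAt_H_div x).continuousAt

lemma continuous_h'_sq (w : ScaledWave h h' H Q Q' ε) : Continuous fun x => h' (Q x ^ 2) :=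
  w.continuousOn_h'.comp_continuous (w.continuous_Q.pow 2) w.sq_pos

lemma continuous_potential (w : ScaledWave h h' H Q Q' ε) : Continuous (potential h h' Q) := by
  have hs := w.continuous_Q.pow 2
  exact ((continuous_const.sub (hs.const_mul 3)).sub w.continuous_h_sq).sub
    ((hs.const_mul 2).mul w.continuous_h'_sq)

lemma sq_le_exp (w : ScaledWave h h' H Q Q' ε) {x : ℝ} (hx : 0 ≤ x) :
    Q x ^ 2 ≤ 10 * exp (-(3 / 2) * x) := by
  set r := logDeriv Q Q' with hr
  have hlt : ∀ x, r x < 1 := fun x => lt_of_abs_lt (w.abs_logDeriv_lt x)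
  have hd : ∀ y, HasDerivAt (fun y => (1 + r y) / (1 - r y) * exp (3 / 2 * y))
      (exp (3 / 2 * y) / (1 - r y) ^ 2
        * (2 * logDeriv' h H Q y + 3 / 2 * (1 - r y ^ 2))) y := by
    intro y
    have h1 : 1 - r y ≠ 0 := (sub_pos.2 (hlt y)).ne'
    have h2 := w.hasDerivAt_logDeriv y
    have h3 : HasDerivAt (fun y : ℝ => 3 / 2 * y) (3 / 2 * 1) y := (hasDerivAt_id y).const_mul _
    refine (((h2.const_add 1).div (h2.const_sub 1) h1).mul h3.exp).congr_deriv ?_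
    simp only [← hr, Pi.div_apply]
    field_simp
    ring
  have hanti : Antitone fun y => (1 + r y) / (1 - r y) * exp (3 / 2 * y) :=
    antitone_of_hasDerivAt_nonpos hd fun y =>
      mul_nonpos_of_nonneg_of_nonpos (by positivity) (by linarith [w.logDeriv'_le y])
  have h0 : r 0 = 0 := by simp [hr, logDeriv, w.deriv_zero]
  have h1 := hanti hx
  simp only [h0, mul_zero, exp_zero, add_zero, sub_zero, div_one, mul_one] at h1
  have hpos := sub_pos.2 (hlt x)
  have hgt := neg_lt_of_abs_lt (w.abs_logDeriv_lt x)
  rw [div_mul_eq_mul_div, div_le_one hpos] at h1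
  have h2 : (1 + r x) ≤ (1 - r x) * exp (-(3 / 2) * x) := by
    have h3 := mul_le_mul_of_nonneg_right h1 (exp_pos (-(3 / 2) * x)).le
    rwa [mul_assoc, ← exp_add, show 3 / 2 * x + -(3 / 2) * x = 0 by ring, exp_zero,
      mul_one] at h3
  have h3 := exp_pos (-(3 / 2) * x)
  have h4 := w.logDeriv_sq_lt x
  have h5 : (1 - r x) * (1 + r x) ≤ 2 * (2 * exp (-(3 / 2) * x)) := by
    refine mul_le_mul (by linarith) (h2.trans ?_) (by linarith) (by norm_num)
    exact mul_le_mul_of_nonneg_right (by linarith) h3.le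
  nlinarith

/-- Exponential decay of the wave. -/
lemma sq_le_weight (w : ScaledWave h h' H Q Q' ε) (x : ℝ) : Q x ^ 2 ≤ 10 * weight x := by
  unfold weight
  rcases le_total 0 x with hx | hx
  · rw [abs_of_nonneg hx]
    exact w.sq_le_exp hx
  · rw [abs_of_nonpos hx, ← w.even]
    exact w.sq_le_exp (neg_nonneg.2 hx)

/-- The diagonal coefficient of the system produced by the Darboux transformation. -/
noncomputable def diagCoeff (h h' H Q : ℝ → ℝ) (x : ℝ) : ℝ :=
  3 * h (Q x ^ 2) - Q x ^ 2 * h' (Q x ^ 2) - 4 * (H (Q x ^ 2) / Q x ^ 2)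

/-- The off-diagonal coefficient of the system produced by the Darboux transformation. -/
noncomputable def offCoeff (h h' H Q : ℝ → ℝ) (x : ℝ) : ℝ :=
  2 * h (Q x ^ 2) - Q x ^ 2 * h' (Q x ^ 2) - 2 * (H (Q x ^ 2) / Q x ^ 2)

lemma continuous_diagCoeff (w : ScaledWave h h' H Q Q' ε) :
    Continuous (diagCoeff h h' H Q) := by
  exact ((w.continuous_h_sq.const_mul 3).sub ((w.continuous_Q.pow 2).mul w.continuous_h'_sq)).sub
    (w.continuous_H_div.const_mul 4)

lemma continuous_offCoeff (w : ScaledWave h h' H Q Q' ε) :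
    Continuous (offCoeff h h' H Q) := by
  exact ((w.continuous_h_sq.const_mul 2).sub ((w.continuous_Q.pow 2).mul w.continuous_h'_sq)).sub
    (w.continuous_H_div.const_mul 2)

lemma abs_diagCoeff_le (w : ScaledWave h h' H Q Q' ε) (x : ℝ) :
    |diagCoeff h h' H Q x| ≤ 60 * ε * weight x := by
  have h1 := abs_le.1 (w.abs_h_le _ (w.sq_pos x) (w.sq_le x))
  have h2 := abs_le.1 (w.abs_sq_mul_h'_le x)
  have h3 := abs_le.1 (w.abs_H_div_le x)
  have h4 := mul_le_mul_of_nonneg_left (w.sq_le_weight x) w.eps_nonneg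
  rw [diagCoeff, abs_le]
  constructor <;> linarith

lemma abs_offCoeff_le (w : ScaledWave h h' H Q Q' ε) (x : ℝ) :
    |offCoeff h h' H Q x| ≤ 60 * ε * weight x := by
  have h1 := abs_le.1 (w.abs_h_le _ (w.sq_pos x) (w.sq_le x))
  have h2 := abs_le.1 (w.abs_sq_mul_h'_le x)
  have h3 := abs_le.1 (w.abs_H_div_le x)
  have h4 := mul_le_mul_of_nonneg_left (w.sq_le_weight x) w.eps_nonneg
  have h5 := mul_nonneg w.eps_nonneg (w.sq_pos x).le
  rw [offCoeff, abs_le]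
  constructor <;> linarith

lemma hasDerivAt_Q' (w : ScaledWave h h' H Q Q' ε) (x : ℝ) :
    HasDerivAt Q' ((logDeriv Q Q' x ^ 2 + logDeriv' h H Q x) * Q x) x :=
  (w.deriv_Q' x).congr_deriv (by rw [w.logDeriv_sq_add]; ring)

/-- The derivative of the wave is in the kernel of the linearized operator. -/
lemma hasDerivAt_Q'' (w : ScaledWave h h' H Q Q' ε) (x : ℝ) :
    HasDerivAt (fun x => (logDeriv Q Q' x ^ 2 + logDeriv' h H Q x) * Q x)
      (potential h h' Q x * Q' x) x := by
  refine ((((w.hasDerivAt_logDeriv x).fun_pow 2).add (w.hasDerivAt_logDeriv' x)).mul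
    (w.deriv_Q x)).congr_deriv ?_
  rw [w.Q'_eq]
  simp only [Pi.add_apply]
  ring

end ScaledWave

/-! ### Exponentially decaying functions -/

/-- `f` decays at least like `e^{-k|x|}`. -/
def ExpBounded (k : ℝ) (f : ℝ → ℝ) : Prop :=
  ∃ C, ∀ x, |f x| ≤ C * exp (-k * |x|)

namespace ExpBounded

variable {k : ℝ} {f g : ℝ → ℝ}

lemma add (hf : ExpBounded k f) (hg : ExpBounded k g) : ExpBounded k fun x => f x + g x := by
  obtain ⟨C, hC⟩ := hf
  obtain ⟨D, hD⟩ := hg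
  refine ⟨C + D, fun x => (abs_add_le _ _).trans ?_⟩
  linarith [hC x, hD x]

lemma bdd_mul {B : ℝ} (hg : ∀ x, |g x| ≤ B) (hf : ExpBounded k f) :
    ExpBounded k fun x => g x * f x := by
  obtain ⟨C, hC⟩ := hf
  refine ⟨B * C, fun x => ?_⟩
  rw [abs_mul, mul_assoc]
  exact mul_le_mul (hg x) (hC x) (abs_nonneg _) ((abs_nonneg _).trans (hg x))

lemma const_mul (c : ℝ) (hf : ExpBounded k f) : ExpBounded k fun x => c * f x :=
  hf.bdd_mul fun _ => le_rfl

lemma sub (hf : ExpBounded k f) (hg : ExpBounded k g) : ExpBounded k fun x => f x - g x := by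
  simpa [sub_eq_add_neg] using hf.add (hg.const_mul (-1))

lemma integrable_sq (hk : 0 < k) (hf : ExpBounded k f) (hc : Continuous f) :
    Integrable fun x => f x ^ 2 := by
  obtain ⟨C, hC⟩ := hf
  refine ((integrable_exp_neg_mul_abs' (c := 2 * k) (by positivity)).const_mul (C ^ 2)).mono'
    (by fun_prop) (Eventually.of_forall fun x => ?_)
  rw [Real.norm_eq_abs, abs_pow]
  refine (pow_le_pow_left₀ (abs_nonneg _) (hC x) 2).trans (le_of_eq ?_)
  rw [mul_pow, ← exp_nat_mul]
  push_cast
  ring_nf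

end ExpBounded

lemma deriv_eq_of_hasDerivAt {V V' : ℝ → ℝ} (h : ∀ x, HasDerivAt V (V' x) x) : deriv V = V' :=
  funext fun x => (h x).deriv

lemma inH2_of_expBounded {k : ℝ} (hk : 0 < k) {V V' V'' : ℝ → ℝ}
    (h : ∀ x, HasDerivAt V (V' x) x) (h' : ∀ x, HasDerivAt V' (V'' x) x) (hc : Continuous V'')
    (hV : ExpBounded k V) (hV' : ExpBounded k V') (hV'' : ExpBounded k V'') : InH2 V := by
  have e := deriv_eq_of_hasDerivAt h
  have e' := deriv_eq_of_hasDerivAt h'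
  have c : Continuous V := continuous_iff_continuousAt.2 fun x => (h x).continuousAt
  have c' : Continuous V' := continuous_iff_continuousAt.2 fun x => (h' x).continuousAt
  refine ⟨?_, hV.integrable_sq hk c, ?_, ?_⟩
  · rw [show (2 : WithTop ℕ∞) = 1 + 1 by norm_num, contDiff_succ_iff_deriv]
    refine ⟨fun x => (h x).differentiableAt, by simp, ?_⟩
    rw [e, contDiff_one_iff_deriv, e']
    exact ⟨fun x => (h' x).differentiableAt, hc⟩
  · rw [e]; exact hV'.integrable_sq hk c'
  · rw [e, e']; exact hV''.integrable_sq hk hc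

lemma vanishes_of_integrable_sq {V V' : ℝ → ℝ} (h : ∀ x, HasDerivAt V (V' x) x)
    (hc : Continuous V') (hV : Integrable fun x => V x ^ 2)
    (hV' : Integrable fun x => V' x ^ 2) : Vanishes V := by
  have c : Continuous V := continuous_iff_continuousAt.2 fun x => (h x).continuousAt
  have hd : ∀ x, HasDerivAt (fun x => V x ^ 2) (2 * V x * V' x) x := fun x =>
    ((h x).fun_pow 2).congr_deriv (by ring)
  have hi : Integrable fun x => 2 * V x * V' x := by
    refine (hV.add hV').mono' (by fun_prop) (Eventually.of_forall fun x => ?_)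
    rw [Real.norm_eq_abs, Pi.add_apply, abs_le]
    constructor <;> nlinarith [sq_nonneg (V x + V' x), sq_nonneg (V x - V' x)]
  have h1 := tendsto_zero_of_hasDerivAt_of_integrableOn_Ioi (a := 0) (fun x _ => hd x)
    hi.integrableOn hV.integrableOn
  have h2 := tendsto_zero_of_hasDerivAt_of_integrableOn_Iic (a := 0) (fun x _ => hd x)
    hi.integrableOn hV.integrableOn
  have key : ∀ {l : Filter ℝ}, Tendsto (fun x => V x ^ 2) l (nhds 0) → Tendsto V l (nhds 0) := by
    intro l hl
    rw [tendsto_zero_iff_abs_tendsto_zero]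
    simpa [Function.comp_def, Real.sqrt_sq_eq_abs] using hl.sqrt
  exact ⟨key h1, key h2⟩

lemma InH2.hasDerivAt {V : ℝ → ℝ} (h : InH2 V) (x : ℝ) : HasDerivAt V (deriv V x) x :=
  (h.1.differentiable (by norm_num) x).hasDerivAt

lemma InH2.contDiff_deriv {V : ℝ → ℝ} (h : InH2 V) : ContDiff ℝ 1 (deriv V) := by
  have h1 := h.1
  rw [show (2 : WithTop ℕ∞) = 1 + 1 by norm_num, contDiff_succ_iff_deriv] at h1
  exact h1.2.2

lemma InH2.hasDerivAt_deriv {V : ℝ → ℝ} (h : InH2 V) (x : ℝ) :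
    HasDerivAt (deriv V) (deriv (deriv V) x) x :=
  (h.contDiff_deriv.differentiable (by norm_num) x).hasDerivAt

lemma InH2.vanishes {V : ℝ → ℝ} (h : InH2 V) : Vanishes V :=
  vanishes_of_integrable_sq h.hasDerivAt h.contDiff_deriv.continuous h.2.1 h.2.2.1

lemma InH2.vanishes_deriv {V : ℝ → ℝ} (h : InH2 V) : Vanishes (deriv V) :=
  vanishes_of_integrable_sq h.hasDerivAt_deriv (contDiff_one_iff_deriv.1 h.contDiff_deriv).2
    h.2.2.1 h.2.2.2

/-! ### The Darboux transformation -/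

/-- `(V₁, V₂)` solves the eigenvalue system of the linearized operators, whose potentials are
`P` and `r² + r₁`. -/
structure LinearizedSolution (r r₁ P : ℝ → ℝ) (lam : ℝ) (V₁ V₁' V₂ V₂' : ℝ → ℝ) : Prop where
  deriv_fst : ∀ x, HasDerivAt V₁ (V₁' x) x
  deriv_fst' : ∀ x, HasDerivAt V₁' (P x * V₁ x - lam * V₂ x) x
  deriv_snd : ∀ x, HasDerivAt V₂ (V₂' x) x
  deriv_snd' : ∀ x, HasDerivAt V₂' ((r x ^ 2 + r₁ x) * V₂ x - lam * V₁ x) x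

/-- The coefficients of the linearized system, with `r` the logarithmic derivative of the wave
and `r₁` its derivative, and of the system with coefficients `p`, `q` to which it is
conjugate. -/
structure DarbouxData (r r₁ P p q : ℝ → ℝ) : Prop where
  deriv_r : ∀ x, HasDerivAt r (r₁ x) x
  deriv_r₁ : ∀ x, HasDerivAt r₁ (P x * r x - 3 * r x * r₁ x - r x ^ 3) x
  potential_eq : ∀ x, P x - 6 * r₁ x = 1 + p x + q x
  dual_eq : ∀ x, r x ^ 2 - r₁ x = 1 + p x - q x
  abs_r_le : ∀ x, |r x| ≤ 1
  abs_r₁_le : ∀ x, |r₁ x| ≤ 3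
  abs_P_le : ∀ x, |P x| ≤ 11
  continuous_P : Continuous P

/-- The intermediate function `V₂' - r V₂`, in terms of the transformed functions. -/
noncomputable def recoverMid (r : ℝ → ℝ) (lam : ℝ) (u u' v v' : ℝ → ℝ) (x : ℝ) : ℝ :=
  -(1 / lam) * ((u' x - v' x) / 2 + r x * ((u x - v x) / 2))

/-- The first component of the inverse Darboux transformation. -/
noncomputable def recoverFst (r : ℝ → ℝ) (lam : ℝ) (u u' v v' : ℝ → ℝ) (x : ℝ) : ℝ :=
  -(1 / lam) * (2 * r x * recoverMid r lam u u' v v' x + (u x + v x) / 2)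

/-- The second component of the inverse Darboux transformation. -/
noncomputable def recoverSnd (r r₁ : ℝ → ℝ) (lam : ℝ) (u u' v v' : ℝ → ℝ) (x : ℝ) : ℝ :=
  1 / lam ^ 2 * (2 * r x * ((u' x + v' x) / 2) + (2 * r x ^ 2 - 2 * r₁ x) * ((u x + v x) / 2)
    - lam * ((u x - v x) / 2))

/-- The derivative of `recoverFst`. -/
noncomputable def recoverFst' (r r₁ : ℝ → ℝ) (lam : ℝ) (u u' v v' : ℝ → ℝ) (x : ℝ) : ℝ :=
  -(1 / lam) * ((u' x + v' x) / 2 + 2 * r₁ x * recoverMid r lam u u' v v' x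
    + 2 * r x * (r x * recoverMid r lam u u' v v' x + (u x + v x) / 2))

/-- The derivative of `recoverSnd`. -/
noncomputable def recoverSnd' (r r₁ : ℝ → ℝ) (lam : ℝ) (u u' v v' : ℝ → ℝ) (x : ℝ) : ℝ :=
  r x * recoverSnd r r₁ lam u u' v v' x + recoverMid r lam u u' v v' x

namespace DarbouxData

variable {r r₁ P p q : ℝ → ℝ} {lam : ℝ} {u u' v v' : ℝ → ℝ}

lemma hasDerivAt_recoverMid (D : DarbouxData r r₁ P p q) (hlam : lam ≠ 0)
    (h : CoupledSolution p q (1 - lam) (1 + lam) u u' v v') (x : ℝ) :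
    HasDerivAt (recoverMid r lam u u' v v')
      (r x * recoverMid r lam u u' v v' x + (u x + v x) / 2) x := by
  refine (((((h.deriv_u' x).sub (h.deriv_v' x)).div_const 2).add ((D.deriv_r x).mul
    (((h.deriv_u x).sub (h.deriv_v x)).div_const 2))).const_mul (-(1 / lam))).congr_deriv ?_
  have := D.dual_eq x
  simp only [recoverMid, Pi.sub_apply]
  field_simp
  linear_combination (u x - v x) * this

lemma linearizedSolution_recover (D : DarbouxData r r₁ P p q) (hlam : lam ≠ 0)
    (h : CoupledSolution p q (1 - lam) (1 + lam) u u' v v') :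
    LinearizedSolution r r₁ P lam (recoverFst r lam u u' v v') (recoverFst' r r₁ lam u u' v v')
      (recoverSnd r r₁ lam u u' v v') (recoverSnd' r r₁ lam u u' v v') := by
  have hY := D.hasDerivAt_recoverMid hlam h
  have hW := fun x => ((h.deriv_u x).add (h.deriv_v x)).div_const 2
  have hW' := fun x => ((h.deriv_u' x).add (h.deriv_v' x)).div_const 2
  have hZ := fun x => ((h.deriv_u x).sub (h.deriv_v x)).div_const 2
  have hr := D.deriv_r
  have hr₁ := D.deriv_r₁
  have hsnd : ∀ x, HasDerivAt (recoverSnd r r₁ lam u u' v v')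
      (recoverSnd' r r₁ lam u u' v v' x) x := fun x => by
    refine ((((((hr x).const_mul 2).mul (hW' x)).add
      (((((hr x).fun_pow 2).const_mul 2).sub ((hr₁ x).const_mul 2)).mul (hW x))).sub
        ((hZ x).const_mul lam)).const_mul (1 / lam ^ 2)).congr_deriv ?_
    have h1 := D.potential_eq x
    have h2 := D.dual_eq x
    simp only [recoverSnd', recoverSnd, recoverMid, Pi.sub_apply, Pi.add_apply]
    field_simp
    have hp : p x = (P x - 6 * r₁ x + r x ^ 2 - r₁ x) / 2 - 1 := by linarith
    have hq : q x = (P x - 6 * r₁ x - r x ^ 2 + r₁ x) / 2 := by linarith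
    rw [hp, hq]
    ring
  refine ⟨fun x => ?_, fun x => ?_, hsnd, fun x => ?_⟩
  · refine (((((hr x).const_mul 2).mul (hY x)).add (hW x)).const_mul (-(1 / lam))).congr_deriv ?_
    simp only [recoverFst']
    ring
  · refine ((((hW' x).add (((hr₁ x).const_mul 2).mul (hY x))).add (((hr x).const_mul 2).mul
      (((hr x).mul (hY x)).add (hW x)))).const_mul (-(1 / lam))).congr_deriv ?_
    have h1 := D.potential_eq x
    have h2 := D.dual_eq x
    have hp : p x = (P x - 6 * r₁ x + r x ^ 2 - r₁ x) / 2 - 1 := by linarith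
    have hq : q x = (P x - 6 * r₁ x - r x ^ 2 + r₁ x) / 2 := by linarith
    simp only [recoverSnd, recoverFst, recoverMid, Pi.add_apply, Pi.mul_apply]
    rw [hp, hq]
    field_simp
    ring
  · refine (((hr x).mul (hsnd x)).add (hY x)).congr_deriv ?_
    simp only [recoverSnd', recoverSnd, recoverFst, recoverMid]
    field_simp
    ring

/-- Solutions of the linearized system are recovered from solutions of the coupled system. -/
lemma exists_coupledSolution (D : DarbouxData r r₁ P p q) (hlam : lam ≠ 0)
    {V₁ V₁' V₂ V₂' : ℝ → ℝ} (h : LinearizedSolution r r₁ P lam V₁ V₁' V₂ V₂')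
    (hV₁ : Vanishes V₁) (hV₁' : Vanishes V₁') (hV₂ : Vanishes V₂) (hV₂' : Vanishes V₂') :
    ∃ u u' v v', CoupledSolution p q (1 - lam) (1 + lam) u u' v v' ∧
      V₁ = recoverFst r lam u u' v v' ∧ V₂ = recoverSnd r r₁ lam u u' v v' := by
  have hr := D.deriv_r
  have hr₁ := D.deriv_r₁
  set Y : ℝ → ℝ := fun x => V₂' x - r x * V₂ x with hY
  set W : ℝ → ℝ := fun x => (-lam) * V₁ x - 2 * (r x * Y x) with hW
  set W' : ℝ → ℝ := fun x => (-lam) * V₁' x - 2 * (r₁ x * Y x) - 2 * (r x * (r x * Y x + W x))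
    with hW'
  set Z : ℝ → ℝ := fun x => 2 * (r x * (r x * V₁ x)) + 2 * (r₁ x * V₁ x) - 2 * (r x * V₁' x)
    - lam * V₂ x with hZ
  set Z' : ℝ → ℝ := fun x => (-lam) * Y x - r x * Z x with hZ'
  have dY : ∀ x, HasDerivAt Y (r x * Y x + W x) x := fun x =>
    ((h.deriv_snd' x).sub ((hr x).mul (h.deriv_snd x))).congr_deriv (by simp only [hY, hW]; ring)
  have dW : ∀ x, HasDerivAt W (W' x) x := fun x =>
    (((h.deriv_fst x).const_mul (-lam)).sub (((hr x).mul (dY x)).const_mul 2)).congr_deriv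
      (by simp only [hW']; ring)
  have dW' : ∀ x, HasDerivAt W' ((1 + p x + q x) * W x - lam * Z x) x := fun x => by
    refine ((((h.deriv_fst' x).const_mul (-lam)).sub (((hr₁ x).mul (dY x)).const_mul 2)).sub
      (((hr x).mul (((hr x).mul (dY x)).add (dW x))).const_mul 2)).congr_deriv ?_
    rw [← D.potential_eq]
    simp only [Pi.mul_apply, Pi.add_apply, hW', hW, hZ, hY]
    ring
  have dZ : ∀ x, HasDerivAt Z (Z' x) x := fun x => by
    refine (((((hr x).mul ((hr x).mul (h.deriv_fst x))).const_mul 2).add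
      (((hr₁ x).mul (h.deriv_fst x)).const_mul 2)).sub
      (((hr x).mul (h.deriv_fst' x)).const_mul 2)).sub ((h.deriv_snd x).const_mul lam)
      |>.congr_deriv ?_
    simp only [Pi.mul_apply, hZ', hZ, hY]
    ring
  have dZ' : ∀ x, HasDerivAt Z' ((1 + p x - q x) * Z x - lam * W x) x := fun x => by
    refine (((dY x).const_mul (-lam)).sub ((hr x).mul (dZ x))).congr_deriv ?_
    rw [← D.dual_eq]
    simp only [hZ']
    ring
  have vY : Vanishes Y := hV₂'.sub (hV₂.bdd_mul D.abs_r_le)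
  have vW : Vanishes W := (hV₁.const_mul _).sub ((vY.bdd_mul D.abs_r_le).const_mul 2)
  have vW' : Vanishes W' := ((hV₁'.const_mul _).sub ((vY.bdd_mul D.abs_r₁_le).const_mul 2)).sub
    ((((vY.bdd_mul D.abs_r_le).add vW).bdd_mul D.abs_r_le).const_mul 2)
  have vZ : Vanishes Z := (((((hV₁.bdd_mul D.abs_r_le).bdd_mul D.abs_r_le).const_mul 2).add
    ((hV₁.bdd_mul D.abs_r₁_le).const_mul 2)).sub ((hV₁'.bdd_mul D.abs_r_le).const_mul 2)).sub
    (hV₂.const_mul lam)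
  have vZ' : Vanishes Z' := (vY.const_mul _).sub (vZ.bdd_mul D.abs_r_le)
  refine ⟨fun x => W x + Z x, fun x => W' x + Z' x, fun x => W x - Z x, fun x => W' x - Z' x,
    ⟨fun x => (dW x).add (dZ x), fun x => ?_, fun x => (dW x).sub (dZ x), fun x => ?_,
      vW.add vZ, vW'.add vZ', vW.sub vZ, vW'.sub vZ'⟩, funext fun x => ?_, funext fun x => ?_⟩
  · exact ((dW' x).add (dZ' x)).congr_deriv (by ring)
  · exact ((dW' x).sub (dZ' x)).congr_deriv (by ring)
  · simp only [recoverFst, recoverMid, hZ', hW]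
    field_simp
    ring
  · simp only [recoverSnd, hW', hW, hZ, hY]
    field_simp
    ring

end DarbouxData

namespace CoupledSolution

variable {p q u u' v v' w w' z z' : ℝ → ℝ} {a b : ℝ}

lemma deriv_eq_of_proportional (h : CoupledSolution p q a b u u' v v')
    (g : CoupledSolution p q a b w w' z z') {c : ℝ} (hu : u = fun x => c * w x)
    (hv : v = fun x => c * z x) : u' = (fun x => c * w' x) ∧ v' = fun x => c * z' x := by
  subst hu hv
  exact ⟨funext fun x => (h.deriv_u x).unique ((g.deriv_u x).const_mul c),
    funext fun x => (h.deriv_v x).unique ((g.deriv_v x).const_mul c)⟩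

lemma deriv_eq_zero (h : CoupledSolution p q a b u u' v v') (hu : u = 0) (hv : v = 0) :
    u' = 0 ∧ v' = 0 := by
  subst hu hv
  exact ⟨funext fun x => (h.deriv_u x).unique (hasDerivAt_const x 0),
    funext fun x => (h.deriv_v x).unique (hasDerivAt_const x 0)⟩

end CoupledSolution

section Recover

variable {r r₁ P p q u u' v v' : ℝ → ℝ} {lam k : ℝ}

lemma recoverFst_const_mul (c : ℝ) :
    recoverFst r lam (fun x => c * u x) (fun x => c * u' x) (fun x => c * v x)
      (fun x => c * v' x) = fun x => c * recoverFst r lam u u' v v' x := by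
  ext x
  simp only [recoverFst, recoverMid]
  ring

lemma recoverSnd_const_mul (c : ℝ) :
    recoverSnd r r₁ lam (fun x => c * u x) (fun x => c * u' x) (fun x => c * v x)
      (fun x => c * v' x) = fun x => c * recoverSnd r r₁ lam u u' v v' x := by
  ext x
  simp only [recoverSnd]
  ring

lemma recoverFst_zero : recoverFst r lam 0 0 0 0 = 0 := by
  ext x
  simp [recoverFst, recoverMid]

lemma recoverSnd_zero : recoverSnd r r₁ lam 0 0 0 0 = 0 := by
  ext x
  simp [recoverSnd]

lemma DarbouxData.not_recover_eq_zero (D : DarbouxData r r₁ P p q) (hlam : lam ≠ 0)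
    (h : CoupledSolution p q (1 - lam) (1 + lam) u u' v v') (hu : u 0 ≠ 0) :
    ¬(recoverFst r lam u u' v v' = 0 ∧ recoverSnd r r₁ lam u u' v v' = 0) := by
  rintro ⟨h1, h2⟩
  have L := D.linearizedSolution_recover hlam h
  have h3 : ∀ x, recoverSnd' r r₁ lam u u' v v' x = 0 := fun x => by
    have := L.deriv_snd x
    rw [h2] at this
    exact this.unique (hasDerivAt_const x 0)
  have h4 : ∀ x, recoverMid r lam u u' v v' x = 0 := fun x => by
    have := h3 x
    simpa [recoverSnd', h2] using this
  have hW : ∀ x, (u x + v x) / 2 = 0 := fun x => by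
    have := congrFun h1 x
    simpa [recoverFst, h4, hlam] using this
  have hW' : ∀ x, (u' x + v' x) / 2 = 0 := fun x => by
    have := ((h.deriv_u x).add (h.deriv_v x)).div_const 2
    refine this.unique ?_
    convert hasDerivAt_const x (0 : ℝ) using 1
    exact funext hW
  have h5 := congrFun h2 0
  simp only [recoverSnd, hW, hW', Pi.zero_apply, mul_zero, add_zero, zero_sub] at h5
  have h6 : u 0 - v 0 = 0 := by
    field_simp at h5
    linarith
  exact hu (by linarith [hW 0])

lemma DarbouxData.inH2_recover (D : DarbouxData r r₁ P p q) (hlam : lam ≠ 0)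
    (h : CoupledSolution p q (1 - lam) (1 + lam) u u' v v') (hk : 0 < k)
    (hu : ExpBounded k u) (hu' : ExpBounded k u') (hv : ExpBounded k v)
    (hv' : ExpBounded k v') :
    InH2 (recoverFst r lam u u' v v') ∧ InH2 (recoverSnd r r₁ lam u u' v v') := by
  have L := D.linearizedSolution_recover hlam h
  have half : ∀ {f g : ℝ → ℝ}, ExpBounded k f → ExpBounded k g →
      ExpBounded k (fun x => (f x + g x) / 2) ∧ ExpBounded k fun x => (f x - g x) / 2 := by
    intro f g hf hg
    constructor
    · simpa [div_eq_inv_mul] using (hf.add hg).const_mul (1 / 2)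
    · simpa [div_eq_inv_mul] using (hf.sub hg).const_mul (1 / 2)
  have hW := (half hu hv).1
  have hZ := (half hu hv).2
  have hW' := (half hu' hv').1
  have hZ' := (half hu' hv').2
  have hY : ExpBounded k (recoverMid r lam u u' v v') :=
    (hZ'.add (hZ.bdd_mul D.abs_r_le)).const_mul _
  have twor : ∀ x, |2 * r x| ≤ 2 := fun x => by
    rw [abs_mul, abs_two]
    linarith [D.abs_r_le x]
  have twor₁ : ∀ x, |2 * r₁ x| ≤ 6 := fun x => by
    rw [abs_mul, abs_two]
    linarith [D.abs_r₁_le x]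
  have rsq : ∀ x, r x ^ 2 ≤ 1 := fun x => (sq_le_one_iff_abs_le_one _).2 (D.abs_r_le x)
  have hdual : ∀ x, |2 * r x ^ 2 - 2 * r₁ x| ≤ 8 := fun x => by
    have h1 := abs_le.1 (D.abs_r₁_le x)
    have h2 := sq_nonneg (r x)
    have h3 := rsq x
    rw [abs_le]
    constructor <;> linarith
  have hpot : ∀ x, |r x ^ 2 + r₁ x| ≤ 4 := fun x => by
    have h1 := abs_le.1 (D.abs_r₁_le x)
    have h2 := sq_nonneg (r x)
    have h3 := rsq x
    rw [abs_le]
    constructor <;> linarith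
  have hV₁ : ExpBounded k (recoverFst r lam u u' v v') :=
    ((hY.bdd_mul twor).add hW).const_mul _
  have hV₁' : ExpBounded k (recoverFst' r r₁ lam u u' v v') :=
    ((hW'.add (hY.bdd_mul twor₁)).add
      (((hY.bdd_mul D.abs_r_le).add hW).bdd_mul twor)).const_mul _
  have hV₂ : ExpBounded k (recoverSnd r r₁ lam u u' v v') :=
    (((hW'.bdd_mul twor).add (hW.bdd_mul hdual)).sub (hZ.const_mul lam)).const_mul _
  have hV₂' : ExpBounded k (recoverSnd' r r₁ lam u u' v v') :=
    (hV₂.bdd_mul D.abs_r_le).add hY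
  have c₁ : Continuous (recoverFst r lam u u' v v') :=
    continuous_iff_continuousAt.2 fun x => (L.deriv_fst x).continuousAt
  have c₂ : Continuous (recoverSnd r r₁ lam u u' v v') :=
    continuous_iff_continuousAt.2 fun x => (L.deriv_snd x).continuousAt
  have cr : Continuous r := continuous_iff_continuousAt.2 fun x => (D.deriv_r x).continuousAt
  have cr₁ : Continuous r₁ := continuous_iff_continuousAt.2 fun x => (D.deriv_r₁ x).continuousAt
  exact ⟨inH2_of_expBounded hk L.deriv_fst L.deriv_fst'
      ((D.continuous_P.mul c₁).sub (c₂.const_mul lam)) hV₁ hV₁'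
      ((hV₁.bdd_mul D.abs_P_le).sub (hV₂.const_mul lam)),
    inH2_of_expBounded hk L.deriv_snd L.deriv_snd'
      ((((cr.pow 2).add cr₁).mul c₂).sub (c₁.const_mul lam)) hV₂ hV₂'
      ((hV₂.bdd_mul hpot).sub (hV₁.const_mul lam))⟩

end Recover

lemma Vanishes.eq_zero_of_hasDerivAt_zero {f : ℝ → ℝ} (hf : Vanishes f)
    (h : ∀ x, HasDerivAt f 0 x) (x : ℝ) : f x = 0 :=
  tendsto_nhds_unique (tendsto_const_nhds.congr fun y => is_const_of_deriv_eq_zero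
    (fun x => (h x).differentiableAt) (fun x => (h x).deriv) x y) hf.1

/-- Uniqueness for the Cauchy problem at `0` of a second order linear equation. -/
lemma eq_zero_of_hasDerivAt_mul {P D D' : ℝ → ℝ} {C : ℝ} (hP : ∀ x, |P x| ≤ C)
    (hD : ∀ x, HasDerivAt D (D' x) x) (hD' : ∀ x, HasDerivAt D' (P x * D x) x)
    (h0 : D 0 = 0) (h0' : D' 0 = 0) (x : ℝ) : D x = 0 := by
  have hd : ∀ c x, HasDerivAt (fun x => (D x ^ 2 + D' x ^ 2) * exp (c * x))
      (exp (c * x) * (2 * D x * D' x * (1 + P x) + c * (D x ^ 2 + D' x ^ 2))) x := fun c x => by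
    refine ((((hD x).fun_pow 2).add ((hD' x).fun_pow 2)).mul
      (((hasDerivAt_id x).const_mul c).exp)).congr_deriv ?_
    simp only [Pi.add_apply, id]
    ring
  have hle : ∀ x, |2 * D x * D' x * (1 + P x)| ≤ (1 + C) * (D x ^ 2 + D' x ^ 2) := fun x => by
    rw [abs_mul, mul_comm]
    refine mul_le_mul ?_ ?_ (abs_nonneg _) ?_
    · exact (abs_add_le _ _).trans (by rw [abs_one]; linarith [hP x])
    · rw [abs_le]
      constructor <;> nlinarith [sq_nonneg (D x + D' x), sq_nonneg (D x - D' x)]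
    · linarith [(abs_nonneg _).trans (hP x)]
  have key : ∀ c, (D x ^ 2 + D' x ^ 2) * exp (c * x) ≤ 0 → D x = 0 := fun c hc => by
    have := nonpos_of_mul_nonpos_left hc (exp_pos _)
    have h1 : D x ^ 2 = 0 := by nlinarith [sq_nonneg (D x), sq_nonneg (D' x)]
    simpa using h1
  rcases le_total 0 x with hx | hx
  · have hanti := antitone_of_hasDerivAt_nonpos (hd (-(1 + C))) fun y =>
      mul_nonpos_of_nonneg_of_nonpos (exp_pos _).le (by linarith [le_of_abs_le (hle y)])
    exact key _ (by simpa [h0, h0'] using hanti hx)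
  · have hmono := monotone_of_hasDerivAt_nonneg (hd (1 + C)) fun y =>
      mul_nonneg (exp_pos _).le (by linarith [neg_le_of_abs_le (hle y)])
    exact key _ (by simpa [h0, h0'] using hmono hx)

namespace ScaledWave

variable {h h' H Q Q' : ℝ → ℝ} {ε : ℝ}

lemma darbouxData (w : ScaledWave h h' H Q Q' ε) :
    DarbouxData (logDeriv Q Q') (logDeriv' h H Q) (potential h h' Q) (diagCoeff h h' H Q)
      (offCoeff h h' H Q) where
  deriv_r := w.hasDerivAt_logDeriv
  deriv_r₁ := w.hasDerivAt_logDeriv'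
  potential_eq x := by
    simp only [potential, logDeriv', diagCoeff, offCoeff]
    ring
  dual_eq x := by
    rw [w.logDeriv_sq]
    simp only [logDeriv', diagCoeff, offCoeff]
    ring
  abs_r_le x := (w.abs_logDeriv_lt x).le
  abs_r₁_le := w.abs_logDeriv'_le
  abs_P_le := w.abs_potential_le
  continuous_P := w.continuous_potential

lemma Lplus_eq (w : ScaledWave h h' H Q Q' ε) (V : ℝ → ℝ) (x : ℝ) :
    Lplus h Q 1 V x = -(deriv (deriv V) x) + potential h h' Q x * V x := by
  rw [Lplus, (w.deriv_h _ (w.sq_pos x)).deriv, potential]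
  ring

lemma Lminus_eq (w : ScaledWave h h' H Q Q' ε) (V : ℝ → ℝ) (x : ℝ) :
    Lminus h Q 1 V x
      = -(deriv (deriv V) x) + (logDeriv Q Q' x ^ 2 + logDeriv' h H Q x) * V x := by
  rw [Lminus, w.logDeriv_sq_add]
  ring

lemma linearizedSolution (w : ScaledWave h h' H Q Q' ε) {W₁ W₂ : ℝ → ℝ} {μ : ℝ}
    (h₁ : InH2 W₁) (h₂ : InH2 W₂) (e₁ : ∀ x, Lplus h Q 1 W₁ x = μ * W₂ x)
    (e₂ : ∀ x, Lminus h Q 1 W₂ x = μ * W₁ x) :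
    LinearizedSolution (logDeriv Q Q') (logDeriv' h H Q) (potential h h' Q) μ
      W₁ (deriv W₁) W₂ (deriv W₂) where
  deriv_fst := h₁.hasDerivAt
  deriv_fst' x := (h₁.hasDerivAt_deriv x).congr_deriv (by
    have := e₁ x
    rw [w.Lplus_eq] at this
    linarith)
  deriv_snd := h₂.hasDerivAt
  deriv_snd' x := (h₂.hasDerivAt_deriv x).congr_deriv (by
    have := e₂ x
    rw [w.Lminus_eq] at this
    linarith)

lemma operators_eq (w : ScaledWave h h' H Q Q' ε) {V₁ V₁' V₂ V₂' : ℝ → ℝ} {μ : ℝ}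
    (L : LinearizedSolution (logDeriv Q Q') (logDeriv' h H Q) (potential h h' Q) μ
      V₁ V₁' V₂ V₂') :
    (∀ x, Lplus h Q 1 V₁ x = μ * V₂ x) ∧ ∀ x, Lminus h Q 1 V₂ x = μ * V₁ x := by
  constructor <;> intro x
  · rw [w.Lplus_eq, deriv_eq_of_hasDerivAt L.deriv_fst, (L.deriv_fst' x).deriv]
    ring
  · rw [w.Lminus_eq, deriv_eq_of_hasDerivAt L.deriv_snd, (L.deriv_snd' x).deriv]
    ring

lemma linearizedSolution_kernel (w : ScaledWave h h' H Q Q' ε) (a b : ℝ) :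
    LinearizedSolution (logDeriv Q Q') (logDeriv' h H Q) (potential h h' Q) 0
      (fun x => a * Q' x) (fun x => a * ((logDeriv Q Q' x ^ 2 + logDeriv' h H Q x) * Q x))
      (fun x => b * Q x) (fun x => b * Q' x) where
  deriv_fst x := (w.hasDerivAt_Q' x).const_mul a
  deriv_fst' x := ((w.hasDerivAt_Q'' x).const_mul a).congr_deriv (by ring)
  deriv_snd x := (w.deriv_Q x).const_mul b
  deriv_snd' x := ((w.hasDerivAt_Q' x).const_mul b).congr_deriv (by ring)

lemma vanishes_Q' (w : ScaledWave h h' H Q Q' ε) : Vanishes Q' := by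
  have := w.vanishes.bdd_mul fun x => (w.abs_logDeriv_lt x).le
  rwa [← funext w.Q'_eq] at this

/-- The decaying solutions in the kernel. -/
lemma exists_of_kernel (w : ScaledWave h h' H Q Q' ε) {W₁ W₁' W₂ W₂' : ℝ → ℝ}
    (L : LinearizedSolution (logDeriv Q Q') (logDeriv' h H Q) (potential h h' Q) 0
      W₁ W₁' W₂ W₂') (v₁ : Vanishes W₁) (v₁' : Vanishes W₁') (v₂ : Vanishes W₂)
    (v₂' : Vanishes W₂') :
    ∃ a b : ℝ, W₁ = (fun x => a * Q' x) ∧ W₂ = fun x => b * Q x := by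
  have hQ'' : (logDeriv Q Q' 0 ^ 2 + logDeriv' h H Q 0) * Q 0 ≠ 0 := by
    have := w.logDeriv'_neg 0
    simp [logDeriv, w.deriv_zero, this.ne, (w.pos 0).ne']
  have vQ'' : Vanishes fun x => (logDeriv Q Q' x ^ 2 + logDeriv' h H Q x) * Q x :=
    w.vanishes.bdd_mul (C := 4) fun x => by
      have h1 := abs_le.1 (w.abs_logDeriv'_le x)
      have h2 := sq_nonneg (logDeriv Q Q' x)
      have h3 := w.logDeriv_sq_lt x
      have h4 := w.sq_pos x
      rw [abs_le]
      constructor <;> linarith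
  refine ⟨W₁' 0 / ((logDeriv Q Q' 0 ^ 2 + logDeriv' h H Q 0) * Q 0), W₂ 0 / Q 0,
    funext fun x => ?_, funext fun x => ?_⟩
  · have hw := ((w.vanishes_Q'.mul v₁').sub (vQ''.mul v₁)).eq_zero_of_hasDerivAt_zero
      (fun x => (((w.hasDerivAt_Q' x).mul (L.deriv_fst' x)).sub
        ((w.hasDerivAt_Q'' x).mul (L.deriv_fst x))).congr_deriv (by ring)) 0
    have h0 : W₁ 0 = 0 := by
      rw [w.deriv_zero, zero_mul, zero_sub, neg_eq_zero] at hw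
      exact (mul_eq_zero.1 hw).resolve_left hQ''
    set a := W₁' 0 / ((logDeriv Q Q' 0 ^ 2 + logDeriv' h H Q 0) * Q 0)
    refine sub_eq_zero.1 (eq_zero_of_hasDerivAt_mul w.abs_potential_le
      (D := fun x => W₁ x - a * Q' x)
      (fun x => (L.deriv_fst x).sub ((w.hasDerivAt_Q' x).const_mul a))
      (fun x => ((L.deriv_fst' x).sub ((w.hasDerivAt_Q'' x).const_mul a)).congr_deriv (by ring))
      ?_ ?_ x)
    · simp [h0, w.deriv_zero]
    · simp only [a]
      rw [div_mul_cancel₀ _ hQ'', sub_self]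
  · have hw := ((w.vanishes.mul v₂').sub (w.vanishes_Q'.mul v₂)).eq_zero_of_hasDerivAt_zero
      (fun x => (((w.deriv_Q x).mul (L.deriv_snd' x)).sub
        ((w.hasDerivAt_Q' x).mul (L.deriv_snd x))).congr_deriv (by ring))
    have hd : ∀ x, HasDerivAt (fun x => W₂ x / Q x) 0 x := fun x => by
      refine ((L.deriv_snd x).div (w.deriv_Q x) (w.pos x).ne').congr_deriv ?_
      rw [div_eq_zero_iff]
      left
      linarith [hw x]
    have := is_const_of_deriv_eq_zero (fun x => (hd x).differentiableAt)
      (fun x => (hd x).deriv) x 0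
    rw [← this, div_mul_cancel₀ _ (ne_of_gt (w.pos x))]

/-- The discrete spectrum of the linearization around the rescaled wave. -/
theorem exists_internal_mode (w : ScaledWave h h' H Q Q' ε) (hε0 : 0 < ε)
    (hε : ε ≤ 1 / 15360) (hneg : ∫ x, diagCoeff h h' H Q x ≤ -(400 * (60 * ε) ^ 2)) :
    ∃ lam, 1 - (180 * ε) ^ 2 ≤ lam ∧ lam < 1 ∧ ∃ V₁ V₂ : ℝ → ℝ,
      InH2 V₁ ∧ InH2 V₂ ∧ ¬(V₁ = 0 ∧ V₂ = 0) ∧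
      (∀ x, Lplus h Q 1 V₁ x = lam * V₂ x) ∧ (∀ x, Lminus h Q 1 V₂ x = lam * V₁ x) ∧
      ∀ (W₁ W₂ : ℝ → ℝ) (μ : ℝ), InH2 W₁ → InH2 W₂ → 0 ≤ μ →
        (((∀ x, Lplus h Q 1 W₁ x = μ * W₂ x) ∧ (∀ x, Lminus h Q 1 W₂ x = μ * W₁ x)) ↔
          ((W₁ = 0 ∧ W₂ = 0) ∨
            (∃ a b : ℝ, W₁ = (fun x => a * Q' x) ∧ W₂ = (fun x => b * Q x) ∧ μ = 0) ∨
            (∃ c : ℝ, W₁ = (fun x => c * V₁ x) ∧ W₂ = (fun x => c * V₂ x) ∧ μ = lam))) := by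
  have D := w.darbouxData
  have hp := w.continuous_diagCoeff
  have hq := w.continuous_offCoeff
  have hpη := w.abs_diagCoeff_le
  have hqη := w.abs_offCoeff_le
  have hη : 60 * ε ≤ 1 / 256 := by linarith
  obtain ⟨k, M, u, u', v, v', hk, hkη, hsol, hu0, hM⟩ :=
    _root_.exists_coupledSolution hp hq hpη hqη (by positivity) hη hneg
  have hk1 : k ≤ 1 / 2 := by linarith
  obtain ⟨lam, rfl⟩ : ∃ lam, lam = 1 - k ^ 2 := ⟨_, rfl⟩
  have hsol' : CoupledSolution (diagCoeff h h' H Q) (offCoeff h h' H Q)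
      (1 - (1 - k ^ 2)) (1 + (1 - k ^ 2)) u u' v v' := by
    convert hsol using 1 <;> ring
  have hlam : 1 - k ^ 2 ≠ 0 := by nlinarith
  have L := D.linearizedSolution_recover hlam hsol'
  obtain ⟨hV₁, hV₂⟩ := D.inH2_recover hlam hsol' hk ⟨M, fun x => (hM x).1⟩
    ⟨M, fun x => (hM x).2.1⟩ ⟨M, fun x => (hM x).2.2.1⟩ ⟨M, fun x => (hM x).2.2.2⟩
  have e := w.operators_eq L
  refine ⟨1 - k ^ 2, by nlinarith, by nlinarith, _, _, hV₁, hV₂,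
    D.not_recover_eq_zero hlam hsol' hu0, e.1, e.2, fun W₁ W₂ μ h₁ h₂ hμ => ⟨?_, ?_⟩⟩
  · rintro ⟨e₁, e₂⟩
    have LW := w.linearizedSolution h₁ h₂ e₁ e₂
    rcases hμ.eq_or_lt with rfl | hμ
    · obtain ⟨a, b, ha, hb⟩ := w.exists_of_kernel LW h₁.vanishes h₁.vanishes_deriv
        h₂.vanishes h₂.vanishes_deriv
      exact .inr (.inl ⟨a, b, ha, hb, rfl⟩)
    obtain ⟨y, y', z, z', hc, rfl, rfl⟩ := D.exists_coupledSolution hμ.ne' LW h₁.vanishes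
      h₁.vanishes_deriv h₂.vanishes h₂.vanishes_deriv
    have hzero : y = 0 → z = 0 → recoverFst (logDeriv Q Q') μ y y' z z' = 0 ∧
        recoverSnd (logDeriv Q Q') (logDeriv' h H Q) μ y y' z z' = 0 := by
      intro hy hz
      obtain ⟨hy', hz'⟩ := hc.deriv_eq_zero hy hz
      rw [hy, hz, hy', hz']
      exact ⟨recoverFst_zero, recoverSnd_zero⟩
    rcases le_or_gt 1 μ with hμ1 | hμ1
    · obtain ⟨hy, hz⟩ := hc.eq_zero_of_nonpos hp hq hpη hqη hη (by linarith) (by linarith)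
      exact .inl (hzero hy hz)
    have hκ : √(1 - μ) ^ 2 = 1 - μ := Real.sq_sqrt (by linarith)
    have hc' : CoupledSolution (diagCoeff h h' H Q) (offCoeff h h' H Q) (√(1 - μ) ^ 2)
        (2 - √(1 - μ) ^ 2) y y' z z' := by
      convert hc using 1
      linarith
    rcases hc'.eq_and_proportional (sqrt_pos.2 (by linarith)) hk
      (sqrt_le_one.2 (by linarith)) (by linarith) hsol hp hq hpη hqη hη hu0 with
      ⟨hy, hz⟩ | ⟨hκk, c, hy, hz⟩
    · exact .inl (hzero hy hz)
    · have hμk : μ = 1 - k ^ 2 := by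
        rw [← hκk, hκ]
        ring
      subst hμk
      obtain ⟨hy', hz'⟩ := hc.deriv_eq_of_proportional hsol' hy hz
      refine .inr (.inr ⟨c, ?_, ?_, rfl⟩)
      · rw [hy, hz, hy', hz', recoverFst_const_mul]
      · rw [hy, hz, hy', hz', recoverSnd_const_mul]
  · rintro (⟨rfl, rfl⟩ | ⟨a, b, rfl, rfl, rfl⟩ | ⟨c, rfl, rfl, rfl⟩)
    · constructor <;> intro x <;> simp [Lplus, Lminus]
    · exact w.operators_eq (w.linearizedSolution_kernel a b)
    · refine w.operators_eq (V₁' := fun x => c * _) (V₂' := fun x => c * _)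
        ⟨fun x => (L.deriv_fst x).const_mul c,
          fun x => ((L.deriv_fst' x).const_mul c).congr_deriv (by ring),
          fun x => (L.deriv_snd x).const_mul c,
          fun x => ((L.deriv_snd' x).const_mul c).congr_deriv (by ring)⟩

end ScaledWave

lemma deriv_comp_div_const (f : ℝ → ℝ) (c : ℝ) :
    deriv (fun y => f (y / c)) = fun y => deriv f (y / c) / c := by
  funext y
  have := deriv_comp_mul_left c⁻¹ f y
  simp only [smul_eq_mul] at this
  simpa [div_eq_inv_mul] using this

lemma deriv_deriv_comp_div_const (f : ℝ → ℝ) (c : ℝ) :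
    deriv (deriv fun y => f (y / c)) = fun y => deriv (deriv f) (y / c) / c ^ 2 := by
  rw [deriv_comp_div_const]
  funext y
  rw [deriv_div_const, congrFun (deriv_comp_div_const (deriv f) c) y, div_div, sq]

lemma InH2.comp_div {V : ℝ → ℝ} (hV : InH2 V) {c : ℝ} (hc : c ≠ 0) :
    InH2 fun y => V (y / c) := by
  obtain ⟨h₀, h₁, h₂, h₃⟩ := hV
  refine ⟨h₀.comp (contDiff_id.div_const c), h₁.comp_div hc, ?_, ?_⟩
  · rw [deriv_comp_div_const]
    simp only [div_pow]
    exact (h₂.comp_div hc).div_const _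
  · rw [deriv_deriv_comp_div_const]
    simp only [div_pow]
    exact (h₃.comp_div hc).div_const _

lemma InH2.comp_mul {V : ℝ → ℝ} (hV : InH2 V) {c : ℝ} (hc : c ≠ 0) :
    InH2 fun y => V (c * y) := by
  simpa [div_eq_mul_inv, mul_comm] using hV.comp_div (inv_ne_zero hc)

section Rescaling

variable {g f : ℝ → ℝ} {ω c : ℝ}

/-- The nonlinearity rescaled to frequency one. -/
noncomputable def rescaledNonlinearity (g : ℝ → ℝ) (ω s : ℝ) : ℝ := g (ω * s) / ω

/-- The wave rescaled to frequency one. -/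
noncomputable def rescaledWave (f : ℝ → ℝ) (c y : ℝ) : ℝ := f (y / c) / c

lemma mul_rescaledWave_sq (hc : c ≠ 0) (hω : c ^ 2 = ω) (y : ℝ) :
    ω * rescaledWave f c y ^ 2 = f (y / c) ^ 2 := by
  rw [rescaledWave, ← hω, div_pow, mul_div_cancel₀ _ (pow_ne_zero 2 hc)]

lemma deriv_rescaledNonlinearity (hω : ω ≠ 0) (s : ℝ) :
    deriv (rescaledNonlinearity g ω) s = deriv g (ω * s) := by
  unfold rescaledNonlinearity
  rw [deriv_div_const, deriv_comp_mul_left ω g s, smul_eq_mul, mul_div_cancel_left₀ _ hω]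

lemma Lplus_rescaled (hc : c ≠ 0) (hω : c ^ 2 = ω) (V : ℝ → ℝ) (y : ℝ) :
    ω * Lplus (rescaledNonlinearity g ω) (rescaledWave f c) 1 (fun y => V (y / c)) y =
      Lplus g f ω V (y / c) := by
  have hω0 : ω ≠ 0 := hω ▸ pow_ne_zero 2 hc
  have hsq := mul_rescaledWave_sq (f := f) hc hω y
  unfold Lplus
  rw [deriv_rescaledNonlinearity hω0, deriv_deriv_comp_div_const, rescaledNonlinearity, hsq,
    hω, ← hsq]
  field_simp

lemma Lminus_rescaled (hc : c ≠ 0) (hω : c ^ 2 = ω) (V : ℝ → ℝ) (y : ℝ) :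
    ω * Lminus (rescaledNonlinearity g ω) (rescaledWave f c) 1 (fun y => V (y / c)) y =
      Lminus g f ω V (y / c) := by
  have hω0 : ω ≠ 0 := hω ▸ pow_ne_zero 2 hc
  have hsq := mul_rescaledWave_sq (f := f) hc hω y
  unfold Lminus
  rw [deriv_deriv_comp_div_const, rescaledNonlinearity, hsq, hω, ← hsq]
  field_simp

lemma Lplus_eq_iff_rescaled (hc : c ≠ 0) (hω : c ^ 2 = ω) (V W : ℝ → ℝ) (μ : ℝ) :
    (∀ x, Lplus g f ω V x = ω * μ * W x) ↔ ∀ y, Lplus (rescaledNonlinearity g ω)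
      (rescaledWave f c) 1 (fun y => V (y / c)) y = μ * W (y / c) := by
  have hω0 : ω ≠ 0 := hω ▸ pow_ne_zero 2 hc
  constructor <;> intro h x
  · apply mul_left_cancel₀ hω0
    rw [Lplus_rescaled hc hω, h, mul_assoc]
  · have := h (c * x)
    rw [← mul_right_inj' hω0, Lplus_rescaled hc hω, mul_div_cancel_left₀ _ hc] at this
    rw [this, mul_assoc]

lemma Lminus_eq_iff_rescaled (hc : c ≠ 0) (hω : c ^ 2 = ω) (V W : ℝ → ℝ) (μ : ℝ) :
    (∀ x, Lminus g f ω V x = ω * μ * W x) ↔ ∀ y, Lminus (rescaledNonlinearity g ω)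
      (rescaledWave f c) 1 (fun y => V (y / c)) y = μ * W (y / c) := by
  have hω0 : ω ≠ 0 := hω ▸ pow_ne_zero 2 hc
  constructor <;> intro h x
  · apply mul_left_cancel₀ hω0
    rw [Lminus_rescaled hc hω, h, mul_assoc]
  · have := h (c * x)
    rw [← mul_right_inj' hω0, Lminus_rescaled hc hω, mul_div_cancel_left₀ _ hc] at this
    rw [this, mul_assoc]

lemma comp_div_eq_iff (hc : c ≠ 0) (V W : ℝ → ℝ) :
    (fun y => V (y / c)) = W ↔ V = fun x => W (c * x) := by
  constructor
  · rintro rfl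
    simp [mul_div_cancel_left₀ _ hc]
  · rintro rfl
    simp [mul_div_cancel₀ _ hc]

end Rescaling

/-- The bounds on `g` near the origin encoded in `eps ω`. -/
lemma eventually_bounds {g : ℝ → ℝ}
    (hH1a : ∀ k : ℕ, k ≤ 4 → Tendsto (fun s : ℝ => s ^ ((k : ℤ) - 1) * iteratedDeriv k g s)
      (nhdsWithin 0 (Set.Ioi 0)) (nhds 0))
    {eps : ℝ → ℝ}
    (heps : ∀ ω : ℝ, 0 < ω → eps ω = sSup
      {v : ℝ | ∃ k : ℕ, k ≤ 4 ∧ ∃ s ∈ Set.Ioc (0:ℝ) (3 * ω),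
        v = |s ^ ((k : ℤ) - 1) * iteratedDeriv k g s|})
    {η : ℝ} (hη : 0 < η) :
    ∀ᶠ ω in nhdsWithin 0 (Set.Ioi 0), 0 ≤ eps ω ∧ eps ω ≤ η ∧
      ∀ s ∈ Set.Ioc (0:ℝ) (3 * ω), |g s| ≤ eps ω * s ∧ |deriv g s| ≤ eps ω := by
  have key : ∀ᶠ s in nhdsWithin (0:ℝ) (Set.Ioi 0), ∀ k ∈ Finset.range 5,
      |s ^ ((k : ℤ) - 1) * iteratedDeriv k g s| ≤ η := by
    refine (Filter.eventually_all_finset _).2 fun k hk => ?_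
    have h := (hH1a k (by simpa [Nat.lt_succ_iff] using hk)).abs
    rw [abs_zero] at h
    exact h.eventually_le_const hη
  obtain ⟨u, hu, hsub⟩ := mem_nhdsGT_iff_exists_Ioc_subset.1 key
  have hu : (0:ℝ) < u := hu
  filter_upwards [Ioc_mem_nhdsGT (show (0:ℝ) < u / 3 by positivity)] with ω hω
  set S := {v : ℝ | ∃ k : ℕ, k ≤ 4 ∧ ∃ s ∈ Set.Ioc (0:ℝ) (3 * ω),
        v = |s ^ ((k : ℤ) - 1) * iteratedDeriv k g s|} with hS
  have hle : ∀ v ∈ S, v ≤ η := by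
    rintro v ⟨k, hk, s, hs, rfl⟩
    exact hsub ⟨hs.1, hs.2.trans (by linarith [hω.2])⟩ k (by simpa [Nat.lt_succ_iff] using hk)
  have hne : S.Nonempty := ⟨_, 0, by norm_num, 3 * ω, ⟨by linarith [hω.1], le_rfl⟩, rfl⟩
  have hb : ∀ v ∈ S, v ≤ eps ω := fun v hv => by
    rw [heps ω hω.1]
    exact le_csSup ⟨η, hle⟩ hv
  refine ⟨?_, ?_, fun s hs => ⟨?_, ?_⟩⟩
  · obtain ⟨v, hv⟩ := hne
    refine le_trans ?_ (hb v hv)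
    obtain ⟨k, -, s, -, rfl⟩ := hv
    exact abs_nonneg _
  · rw [heps ω hω.1]
    exact csSup_le hne hle
  · have := hb _ ⟨0, by norm_num, s, hs, rfl⟩
    rw [iteratedDeriv_zero, abs_mul] at this
    norm_num at this
    rwa [abs_of_pos hs.1, inv_mul_le_iff₀ hs.1, mul_comm] at this
  · have := hb _ ⟨1, by norm_num, s, hs, rfl⟩
    simpa [iteratedDeriv_one] using this

/-- The rescaled solitary wave solves the rescaled equation. -/
lemma scaledWave_rescaled {g G f : ℝ → ℝ} {ω c ε : ℝ} (hg : ContinuousOn g (Set.Ici 0))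
    (hg' : ContDiffOn ℝ 1 g (Set.Ioi 0)) (hG : ∀ s, G s = ∫ t in (0:ℝ)..s, g t)
    (hc : 0 < c) (hω : c ^ 2 = ω)
    (hfpos : ∀ x, 0 < f x) (hfeven : ∀ x, f (-x) = f x) (hfC2 : ContDiff ℝ 2 f)
    (hftop : Tendsto f atTop (nhds 0)) (hfbot : Tendsto f atBot (nhds 0))
    (hfeq : ∀ x, deriv (deriv f) x = ω * f x - f x ^ 3 - f x * g (f x ^ 2))
    (hε : ε ≤ 1 / 15) (hbd : ∀ s ∈ Set.Ioc (0:ℝ) (3 * ω), |g s| ≤ ε * s ∧ |deriv g s| ≤ ε) :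
    ScaledWave (rescaledNonlinearity g ω) (fun s => deriv g (ω * s)) (fun s => G (ω * s) / ω ^ 2)
      (rescaledWave f c) (fun y => deriv f (y / c) / ω) ε := by
  have hω0 : 0 < ω := hω ▸ pow_pos hc 2
  have hmem : ∀ {s : ℝ}, 0 < s → s ≤ 3 → ω * s ∈ Set.Ioc 0 (3 * ω) := fun h₀ h₃ =>
    ⟨mul_pos hω0 h₀, by rw [mul_comm 3]; gcongr⟩
  have hdg : ∀ s, 0 < s → HasDerivAt g (deriv g s) s := fun s hs =>
    ((hg'.contDiffAt (Ioi_mem_nhds hs)).differentiableAt one_ne_zero).hasDerivAt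
  have hmul : ∀ s, HasDerivAt (fun s => ω * s) ω s := fun s => by
    simpa using (hasDerivAt_id s).const_mul ω
  have hdiv : ∀ y, HasDerivAt (fun y => y / c) (1 / c) y := fun y => (hasDerivAt_id y).div_const c
  have hf1 : ContDiff ℝ 1 (deriv f) :=
    ((contDiff_succ_iff_deriv (n := 1)).1 (by simpa [one_add_one_eq_two] using hfC2)).2.2
  have hint : ∀ s, 0 ≤ s → IntervalIntegrable g volume 0 s := fun s hs =>
    (hg.mono fun t ht => by
      rw [Set.uIcc_of_le hs] at ht
      exact ht.1).intervalIntegrable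
  refine
    { pos := fun y => div_pos (hfpos _) hc
      even := fun y => by rw [rescaledWave, neg_div, hfeven, rescaledWave]
      deriv_Q := fun y => ?_
      deriv_Q' := fun y => ?_
      vanishes := ⟨?_, ?_⟩
      deriv_h := fun s hs => ?_
      deriv_H := fun s hs => ?_
      continuousOn_h' := ?_
      abs_h_le := fun s h₀ h₃ => ?_
      abs_h'_le := fun s h₀ h₃ => (hbd _ (hmem h₀ h₃)).2
      abs_H_le := fun s h₀ h₃ => ?_
      le_eps := hε }
  · refine ((((hfC2.differentiable two_ne_zero) (y / c)).hasDerivAt.comp y (hdiv y)).div_const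
      c).congr_deriv ?_
    rw [← hω]
    field_simp
  · refine ((((hf1.differentiable one_ne_zero) (y / c)).hasDerivAt.comp y (hdiv y)).div_const
      ω).congr_deriv ?_
    rw [hfeq, rescaledNonlinearity, mul_rescaledWave_sq hc.ne' hω, rescaledWave, ← hω]
    field_simp
  · change Tendsto (fun y => f (y / c) / c) _ _
    simpa [Function.comp_def] using (hftop.comp (tendsto_id.atTop_div_const hc)).div_const c
  · change Tendsto (fun y => f (y / c) / c) _ _
    simpa [Function.comp_def] using (hfbot.comp (tendsto_id.atBot_div_const hc)).div_const c
  · refine (((hdg _ (mul_pos hω0 hs)).comp s (hmul s)).div_const ω).congr_deriv ?_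
    field_simp
  · have hs' := mul_pos hω0 hs
    have hGd : HasDerivAt G (g (ω * s)) (ω * s) := by
      rw [funext hG]
      exact intervalIntegral.integral_hasDerivAt_right (hint _ hs'.le)
        ((hg.mono Set.Ioi_subset_Ici_self).stronglyMeasurableAtFilter isOpen_Ioi _ hs')
        (hdg _ hs').continuousAt
    refine ((hGd.comp s (hmul s)).div_const (ω ^ 2)).congr_deriv ?_
    rw [rescaledNonlinearity]
    field_simp
  · exact (hg'.continuousOn_deriv_of_isOpen isOpen_Ioi le_rfl).comp (by fun_prop)
      fun s hs => mul_pos hω0 hs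
  · rw [rescaledNonlinearity, abs_div, abs_of_pos hω0, div_le_iff₀ hω0]
    exact (hbd _ (hmem h₀ h₃)).1.trans_eq (by ring)
  · have hs' := hmem h₀ h₃
    have hle : |G (ω * s)| ≤ ∫ t in (0:ℝ)..ω * s, ε * t := by
      have hcont : Continuous fun t => ε * t := by fun_prop
      rw [hG, ← Real.norm_eq_abs]
      exact intervalIntegral.norm_integral_le_of_norm_le hs'.1.le
        (ae_of_all _ fun t ht => (hbd t ⟨ht.1, ht.2.trans hs'.2⟩).1)
        (hcont.intervalIntegrable _ _)
    rw [intervalIntegral.integral_const_mul, integral_id] at hle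
    rw [abs_div, abs_of_pos (pow_pos hω0 2), div_le_iff₀ (pow_pos hω0 2)]
    exact hle.trans_eq (by ring)

/-- The rescaled form of the integral of `𝔅` along the wave. -/
lemma integral_diagCoeff_rescaled {g G B f : ℝ → ℝ} {ω c : ℝ}
    (hB : ∀ s : ℝ, 0 < s → B s = -3 * g s + s * deriv g s + 4 * G s / s)
    (hc : 0 < c) (hω : c ^ 2 = ω) (hfpos : ∀ x, 0 < f x) :
    c * ∫ y, ScaledWave.diagCoeff (rescaledNonlinearity g ω) (fun s => deriv g (ω * s))
      (fun s => G (ω * s) / ω ^ 2) (rescaledWave f c) y = -∫ x, B (f x ^ 2) := by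
  have hω0 : 0 < ω := hω ▸ pow_pos hc 2
  have hpt : ∀ y, ScaledWave.diagCoeff (rescaledNonlinearity g ω) (fun s => deriv g (ω * s))
      (fun s => G (ω * s) / ω ^ 2) (rescaledWave f c) y = -(1 / ω) * B (f (y / c) ^ 2) := by
    intro y
    have hf := (hfpos (y / c)).ne'
    have hsq := mul_rescaledWave_sq (f := f) hc.ne' hω y
    have hQ : rescaledWave f c y ^ 2 = f (y / c) ^ 2 / ω := by
      rw [← hsq, mul_div_cancel_left₀ _ hω0.ne']
    rw [hB _ (pow_pos (hfpos _) 2), ScaledWave.diagCoeff, rescaledNonlinearity, hsq, hQ]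
    field_simp
    ring
  simp_rw [hpt]
  rw [integral_const_mul, Measure.integral_comp_div (fun x => B (f x ^ 2)) c, abs_of_pos hc,
    smul_eq_mul, ← hω]
  field_simp

theorem stmt0
    -- the nonlinearity `g`
    (g : ℝ → ℝ) (hg0 : g 0 = 0)
    (hgC1 : ContDiffOn ℝ 1 g (Set.Ici 0))
    (hgC5 : ContDiffOn ℝ 5 g (Set.Ioi 0))
    -- hypothesis (H₁)
    (hH1a : ∀ k : ℕ, k ≤ 4 →
      Tendsto (fun s : ℝ => s ^ ((k : ℤ) - 1) * iteratedDeriv k g s)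
        (nhdsWithin 0 (Set.Ioi 0)) (nhds 0))
    (hH1b : ∃ C₀ : ℝ, 0 < C₀ ∧ ∃ s₀ : ℝ, 0 < s₀ ∧ ∀ s ∈ Set.Ioo (0:ℝ) s₀,
      |iteratedDeriv 5 g s| ≤ C₀ * s ^ (-4 : ℤ))
    (hH1c : ∀ η : ℝ, 0 < η → ∃ s ∈ Set.Ioo (0:ℝ) η, g s ≠ 0)
    -- the quantities `G`, `𝔅` and `ε_ω`
    (G : ℝ → ℝ) (hG : ∀ s, G s = ∫ t in (0:ℝ)..s, g t)
    (B : ℝ → ℝ) (hB : ∀ s : ℝ, 0 < s → B s = -3 * g s + s * deriv g s + 4 * G s / s)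
    (eps : ℝ → ℝ)
    (heps : ∀ ω : ℝ, 0 < ω → eps ω = sSup
      {v : ℝ | ∃ k : ℕ, k ≤ 4 ∧ ∃ s ∈ Set.Ioc (0:ℝ) (3 * ω),
        v = |s ^ ((k : ℤ) - 1) * iteratedDeriv k g s|})
    -- the family of solitary waves `φ_ω`
    (ωstar : ℝ) (hωstar : 0 < ωstar)
    (φ : ℝ → ℝ → ℝ)
    (hφpos : ∀ ω ∈ Set.Ioo (0:ℝ) ωstar, ∀ x, 0 < φ ω x)
    (hφeven : ∀ ω ∈ Set.Ioo (0:ℝ) ωstar, ∀ x, φ ω (-x) = φ ω x)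
    (hφC2 : ∀ ω ∈ Set.Ioo (0:ℝ) ωstar, ContDiff ℝ 2 (φ ω))
    (hφdecay : ∀ ω ∈ Set.Ioo (0:ℝ) ωstar,
      Tendsto (φ ω) atTop (nhds 0) ∧ Tendsto (φ ω) atBot (nhds 0))
    (hφeq : ∀ ω ∈ Set.Ioo (0:ℝ) ωstar, ∀ x,
      deriv (deriv (φ ω)) x = ω * φ ω x - φ ω x ^ 3 - φ ω x * g (φ ω x ^ 2))
    -- hypothesis (H₂)
    (hH2 : Tendsto (fun ω : ℝ => (1 / (eps ω ^ 2 * Real.sqrt ω)) * ∫ x : ℝ, B (φ ω x ^ 2))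
      (nhdsWithin 0 (Set.Ioi 0)) atTop) :
    ∀ δ ∈ Set.Ioo (0:ℝ) 1, ∃ ω₁ ∈ Set.Ioo (0:ℝ) ωstar, ∀ ω ∈ Set.Ioo (0:ℝ) ω₁,
      ∃ lam ∈ Set.Ioo (1 - δ) 1, ∃ V₁ V₂ : ℝ → ℝ,
        InH2 V₁ ∧ InH2 V₂ ∧ ¬(V₁ = 0 ∧ V₂ = 0) ∧
        (∀ x, Lplus g (φ ω) ω V₁ x = ω * lam * V₂ x) ∧
        (∀ x, Lminus g (φ ω) ω V₂ x = ω * lam * V₁ x) ∧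
        (∀ (W₁ W₂ : ℝ → ℝ) (μ : ℝ), InH2 W₁ → InH2 W₂ → 0 ≤ μ →
          (((∀ x, Lplus g (φ ω) ω W₁ x = μ * W₂ x) ∧
              (∀ x, Lminus g (φ ω) ω W₂ x = μ * W₁ x)) ↔
            ((W₁ = 0 ∧ W₂ = 0) ∨
              (∃ a b : ℝ, W₁ = (fun x => a * deriv (φ ω) x) ∧
                W₂ = (fun x => b * φ ω x) ∧ μ = 0) ∨
              (∃ c : ℝ, W₁ = (fun x => c * V₁ x) ∧ W₂ = (fun x => c * V₂ x) ∧
                μ = ω * lam)))) := by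
  intro δ hδ
  obtain ⟨η, hη0, hη⟩ : ∃ η : ℝ, 0 < η ∧ η ≤ 1 / 15360 ∧ (180 * η) ^ 2 < δ := by
    refine ⟨δ / 15360, by linarith [hδ.1], by linarith [hδ.2], ?_⟩
    nlinarith [hδ.1, hδ.2, mul_pos hδ.1 hδ.1]
  have hev := ((eventually_bounds hH1a heps hη0).and (hH2.eventually_ge_atTop (400 * 60 ^ 2))).and
    (Ioo_mem_nhdsGT hωstar)
  obtain ⟨u, hu, hsub⟩ := mem_nhdsGT_iff_exists_Ioo_subset.1 hev
  have hu : (0:ℝ) < u := hu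
  refine ⟨min u (ωstar / 2), ⟨by positivity, (min_le_right _ _).trans_lt (by linarith)⟩,
    fun ω hω => ?_⟩
  obtain ⟨⟨⟨heps0, hepsη, hbd⟩, hratio⟩, hωmem⟩ := hsub ⟨hω.1, hω.2.trans_le (min_le_left _ _)⟩
  have hω0 : 0 < ω := hω.1
  obtain ⟨c, hc, hcω, hcs⟩ : ∃ c : ℝ, 0 < c ∧ c ^ 2 = ω ∧ √ω = c :=
    ⟨√ω, sqrt_pos.2 hω0, sq_sqrt hω0.le, rfl⟩
  have hepspos : 0 < eps ω := by
    refine heps0.lt_of_ne fun h => ?_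
    norm_num [← h] at hratio
  have w := scaledWave_rescaled hgC1.continuousOn (hgC5.of_le (by norm_num)) hG hc hcω
    (hφpos ω hωmem) (hφeven ω hωmem) (hφC2 ω hωmem) (hφdecay ω hωmem).1 (hφdecay ω hωmem).2
    (hφeq ω hωmem) (by linarith [hη.1]) hbd
  have hneg := integral_diagCoeff_rescaled hB hc hcω (hφpos ω hωmem)
  rw [hcs, one_div_mul_eq_div, le_div_iff₀ (by positivity)] at hratio
  obtain ⟨lam, hlam, hlam1, V₁, V₂, hV₁, hV₂, hV0, e₁, e₂, hall⟩ :=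
    w.exists_internal_mode hepspos (hepsη.trans hη.1) (by
      refine le_of_mul_le_mul_left ?_ hc
      rw [hneg]
      linarith)
  have hsq : (180 * eps ω) ^ 2 ≤ (180 * η) ^ 2 := by gcongr
  refine ⟨lam, ⟨by linarith [hη.2], hlam1⟩, fun x => V₁ (c * x), fun x => V₂ (c * x),
    hV₁.comp_mul hc.ne', hV₂.comp_mul hc.ne', ?_, ?_, ?_, fun W₁ W₂ μ h₁ h₂ hμ => ?_⟩
  · rintro ⟨h₁, h₂⟩
    refine hV0 ⟨funext fun y => ?_, funext fun y => ?_⟩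
    · simpa [mul_div_cancel₀ _ hc.ne'] using congrFun h₁ (y / c)
    · simpa [mul_div_cancel₀ _ hc.ne'] using congrFun h₂ (y / c)
  · rw [Lplus_eq_iff_rescaled hc.ne' hcω]
    simpa [mul_div_cancel₀ _ hc.ne'] using e₁
  · rw [Lminus_eq_iff_rescaled hc.ne' hcω]
    simpa [mul_div_cancel₀ _ hc.ne'] using e₂
  obtain ⟨ν, rfl⟩ : ∃ ν, μ = ω * ν := ⟨μ / ω, (mul_div_cancel₀ _ hω0.ne').symm⟩
  rw [Lplus_eq_iff_rescaled hc.ne' hcω, Lminus_eq_iff_rescaled hc.ne' hcω,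
    hall _ _ ν (h₁.comp_div hc.ne') (h₂.comp_div hc.ne') (nonneg_of_mul_nonneg_right hμ hω0)]
  simp only [comp_div_eq_iff hc.ne', mul_eq_zero, hω0.ne', false_or, mul_right_inj' hω0.ne',
    rescaledWave, mul_div_cancel_left₀ _ hc.ne']
  refine or_congr Iff.rfl (or_congr ⟨?_, ?_⟩ Iff.rfl)
  · rintro ⟨a, b, rfl, rfl, h⟩
    exact ⟨a / ω, b / c, funext fun x => by ring, funext fun x => by ring, h⟩
  · rintro ⟨a, b, rfl, rfl, h⟩
    exact ⟨a * ω, b * c, funext fun x => by field_simp, funext fun x => by field_simp, h⟩
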